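/- For every m ≥ 8, the covering radius of RM(m−4, m) in RM(m−3, m) is at least 2m+10; that is, there exists a Boolean function f on m variables of degree at most m−3 such that for every Boolean function p of degree at most m−4, the weight of f + p is at least 2m+10. -/

import Mathlib

open MvPolynomial

/-- A Boolean function on `m` variables over 𝔽₂. -/
abbrev BF (m : ℕ) := (Fin m → ZMod 2) → ZMod 2

/-- The unique multilinear polynomial over 𝔽₂ representing the Boolean function `f`
(obtained by interpolation: `∏ i (Xᵢ + vᵢ + 1)` is the indicator of the input `v`). -/
noncomputable def repPoly {m : ℕ} (f : BF m) : MvPolynomial (Fin m) (ZMod 2) :=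
  ∑ v : Fin m → ZMod 2, f v • ∏ i : Fin m, (X i + C (v i + 1))

/-- The degree of a Boolean function: the total degree of its multilinear representative. -/
noncomputable def deg {m : ℕ} (f : BF m) : ℕ := (repPoly f).totalDegree

/-- The weight of a Boolean function: the number of inputs on which it takes the value 1. -/
noncomputable def wt {m : ℕ} (f : BF m) : ℕ :=
  (Finset.univ.filter fun v => f v = 1).card

/-- The distance from `f` to the Reed–Muller code `RM(r,m)`: the minimum weight of
`f + p` over Boolean functions `p` of degree at most `r`. -/
noncomputable def distRM (m r : ℕ) (f : BF m) : ℕ :=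
  sInf {w | ∃ p : BF m, deg p ≤ r ∧ wt (f + p) = w}

/-- Three-dimensional space over 𝔽₂. -/
abbrev V3 := Fin 3 → ZMod 2

/-- The cross product on `𝔽₂³`. -/
def cr (a b : V3) : V3 :=
  ![a 1 * b 2 + a 2 * b 1, a 2 * b 0 + a 0 * b 2, a 0 * b 1 + a 1 * b 0]

/-- The dot product on `𝔽₂³`. -/
def dt (a b : V3) : ZMod 2 := a 0 * b 0 + a 1 * b 1 + a 2 * b 2

/-- Multiplication by a root of `X³ + X + 1`, in coordinates. -/
def th (a : V3) : V3 := ![a 2, a 0 + a 2, a 1]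

set_option maxRecDepth 100000 in
theorem plane_indicator (b d e : V3) (h : cr d e ≠ 0) :
    (if b = 0 then 1 else 0 : ZMod 2) + (if b = d then 1 else 0) + (if b = e then 1 else 0)
      + (if b = d + e then 1 else 0) = dt (cr d e) b + 1 := by
  revert b d e; decide

set_option maxRecDepth 100000 in
theorem cr_th_ne_zero : ∀ w : V3, w ≠ 0 → cr w (th w) ≠ 0 := by decide

set_option maxRecDepth 100000 in
theorem eq_zero_of_dt_two : ∀ r v w : V3, cr v w ≠ 0 → dt r v = 0 → dt r w = 0 →
    dt r (th v) = 0 → dt r (th w) = 0 → r = 0 := by decide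

set_option maxRecDepth 100000 in
set_option synthInstance.maxSize 1000 in
theorem eq_zero_of_dt_pencil : ∀ v w r q : V3, cr v w ≠ 0 → dt r v = 0 → dt q w = 0 →
    dt r (th v) = 0 → dt q (th w) = 0 → dt (r + q) (v + w) = 0 →
    dt (r + q) (th (v + w)) = 0 → r = 0 := by decide

set_option maxRecDepth 100000 in
set_option synthInstance.maxSize 1000 in
theorem eq_zero_of_dt_frame : ∀ u v w r : V3, dt u (cr v w) ≠ 0 → dt r (cr u (th u)) = 0 →
    dt r (cr v (th v)) = 0 → dt r (cr w (th w)) = 0 →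
    dt r (cr (u + v + w) (th (u + v + w))) = 0 → r = 0 := by decide

theorem zmod2_eq_zero_or_one (a : ZMod 2) : a = 0 ∨ a = 1 := by
  revert a; decide

theorem zmod2_add_self (a : ZMod 2) : a + a = 0 := CharTwo.add_self_eq_zero a

section Fibres

variable {ι : Type*}

/-- The sum of `g` over the points of `S` at which `b` takes the value `β`. -/
def fs (S : Finset ι) (b : ι → V3) (g : ι → ZMod 2) (β : V3) : ZMod 2 :=
  ∑ x ∈ S with b x = β, g x

theorem fs_eq (S : Finset ι) (b : ι → V3) (g : ι → ZMod 2) (β : V3) :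
    fs S b g β = ∑ x ∈ S, g x * (if b x = β then 1 else 0) := by
  simp [fs, Finset.sum_filter]

theorem fs_eq_top (S : Finset ι) (b : ι → V3) (g : ι → ZMod 2)
    (h0 : ∑ x ∈ S, g x = 0) (h1 : ∀ j, ∑ x ∈ S, g x * b x j = 0)
    (h2 : ∀ i j, ∑ x ∈ S, g x * b x i * b x j = 0) (β : V3) :
    fs S b g β = ∑ x ∈ S, g x * b x 0 * b x 1 * b x 2 := by
  have key : ∀ a β : V3, (if a = β then 1 else 0 : ZMod 2)
      = (a 0 + (β 0 + 1)) * (a 1 + (β 1 + 1)) * (a 2 + (β 2 + 1)) := by decide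
  rw [fs_eq]
  have : ∀ x ∈ S, g x * (if b x = β then 1 else 0 : ZMod 2) =
      g x * b x 0 * b x 1 * b x 2 + (β 2 + 1) * (g x * b x 0 * b x 1)
      + (β 1 + 1) * (g x * b x 0 * b x 2) + (β 0 + 1) * (g x * b x 1 * b x 2)
      + (β 1 + 1) * (β 2 + 1) * (g x * b x 0) + (β 0 + 1) * (β 2 + 1) * (g x * b x 1)
      + (β 0 + 1) * (β 1 + 1) * (g x * b x 2) + (β 0 + 1) * (β 1 + 1) * (β 2 + 1) * g x := by
    intro x _
    rw [key]; ring
  rw [Finset.sum_congr rfl this]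
  simp only [Finset.sum_add_distrib, ← Finset.mul_sum, h0, h1, h2]
  ring

theorem fs_plane (S : Finset ι) (b : ι → V3) (g : ι → ZMod 2) (c : V3)
    (h0 : ∑ x ∈ S, g x = 0) (h1 : ∀ j, ∑ x ∈ S, g x * b x j = c j)
    (β d e : V3) (hde : cr d e ≠ 0) :
    fs S b g β + fs S b g (β + d) + fs S b g (β + e) + fs S b g (β + (d + e))
      = dt (cr d e) c := by
  have sh : ∀ a d : V3, (a = β + d) ↔ (a + β = d) := by
    intro a d
    constructor
    · rintro rfl
      ext i; simp only [Pi.add_apply]; linear_combination CharTwo.add_self_eq_zero (β i)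
    · rintro rfl
      ext i; simp only [Pi.add_apply]; linear_combination - CharTwo.add_self_eq_zero (β i)
  have sh0 : ∀ a : V3, (a = β) ↔ (a + β = 0) := by
    intro a; simpa using sh a 0
  simp only [fs_eq, ← Finset.sum_add_distrib, sh]
  have : ∀ x ∈ S, g x * (if b x = β then 1 else 0) + g x * (if b x + β = d then 1 else 0)
      + g x * (if b x + β = e then 1 else 0) + g x * (if b x + β = d + e then 1 else 0)
      = cr d e 0 * (g x * b x 0) + cr d e 1 * (g x * b x 1) + cr d e 2 * (g x * b x 2)
        + (dt (cr d e) β + 1) * g x := by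
    intro x _
    have := plane_indicator (b x + β) d e hde
    simp only [sh0]
    rw [← mul_add, ← mul_add, ← mul_add, this]
    simp only [dt, Pi.add_apply]; ring
  rw [Finset.sum_congr rfl this]
  simp only [Finset.sum_add_distrib, ← Finset.mul_sum, h0, h1, dt]
  ring

theorem sum_mul_eq_zero_of_card_le_two (F : Finset ι) (hc : F.card ≤ 2)
    (he : (F.card : ZMod 2) = 0) (g h : ι → ZMod 2) (hg : ∑ x ∈ F, g x = 0)
    (hh : ∑ x ∈ F, h x = 0) : ∑ x ∈ F, g x * h x = 0 := by
  classical
  rcases Nat.lt_or_ge F.card 1 with h0 | h1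
  · obtain rfl : F = ∅ := Finset.card_eq_zero.1 (by omega)
    simp
  rcases Nat.lt_or_ge F.card 2 with h0 | h2
  · have : F.card = 1 := by omega
    rw [this] at he; exact absurd he (by decide)
  · obtain ⟨a, b, hab, rfl⟩ := Finset.card_eq_two.1 (le_antisymm hc h2)
    rw [Finset.sum_pair hab] at *
    generalize g a = a1 at *; generalize g b = b1 at *
    generalize h a = a2 at *; generalize h b = b2 at *
    revert a1 b1 a2 b2; decide

theorem pfaffian_of_card_eq_four (F : Finset ι) (hc : F.card = 4) (g : Fin 4 → ι → ZMod 2)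
    (hg : ∀ i, ∑ x ∈ F, g i x = 0) :
    (∑ x ∈ F, g 0 x * g 1 x) * (∑ x ∈ F, g 2 x * g 3 x)
      + (∑ x ∈ F, g 0 x * g 2 x) * (∑ x ∈ F, g 1 x * g 3 x)
      + (∑ x ∈ F, g 0 x * g 3 x) * (∑ x ∈ F, g 1 x * g 2 x) = 0 := by
  classical
  obtain ⟨a, s, ha, rfl, hs⟩ := Finset.card_eq_succ.1 hc
  obtain ⟨b, c, d, hbc, hbd, hcd, rfl⟩ := Finset.card_eq_three.1 hs
  have hsum : ∀ f : ι → ZMod 2, ∑ x ∈ insert a {b, c, d}, f x = f a + f b + f c + f d := by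
    intro f
    rw [Finset.sum_insert ha, Finset.sum_insert (by simp [hbc, hbd]), Finset.sum_pair hcd]; ring
  have ht : ∀ i, g i a = g i b + g i c + g i d := by
    intro i
    have := hg i
    rw [hsum] at this
    have h2 := CharTwo.add_self_eq_zero (g i b + g i c + g i d)
    linear_combination this - h2
  simp only [hsum, ht]
  ring_nf
  reduce_mod_char

theorem sum_triple_eq_zero_of_card_lt_eight (F : Finset ι) (hc : F.card < 8)
    (he : (F.card : ZMod 2) = 0) (k : ι → V3) (h1 : ∀ i, ∑ x ∈ F, k x i = 0)
    (h2 : ∀ i j, ∑ x ∈ F, k x i * k x j = 0) :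
    ∑ x ∈ F, k x 0 * k x 1 * k x 2 = 0 := by
  by_contra hne
  have hfib : ∀ κ : V3, fs F k (fun _ => 1) κ ≠ 0 := by
    intro κ
    rw [fs_eq_top F k (fun _ => 1) (by simpa using he) (by simpa using h1) (by simpa using h2)]
    simpa using hne
  have hsub : (Finset.univ : Finset V3) ⊆ F.image k := by
    intro κ _
    have := hfib κ
    unfold fs at this
    obtain ⟨x, hx, -⟩ := Finset.exists_ne_zero_of_sum_ne_zero this
    rw [Finset.mem_filter] at hx
    exact Finset.mem_image.2 ⟨x, hx.1, hx.2⟩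
  have := (Finset.card_le_card hsub).trans Finset.card_image_le
  simp at this
  omega

end Fibres

theorem cr_ne_zero_of_ne : ∀ u v : V3, u ≠ 0 → v ≠ 0 → u ≠ v → cr u v ≠ 0 := by decide

set_option maxRecDepth 100000 in
set_option synthInstance.maxSize 1000 in
theorem dt_ne_zero_of_notMem_plane : ∀ u v w : V3, cr u v ≠ 0 → w ≠ 0 → w ≠ u → w ≠ v →
    w ≠ u + v → dt w (cr u v) ≠ 0 := by decide

theorem exists_dt_ne_zero : ∀ c : V3, c ≠ 0 → ∃ w, dt w c ≠ 0 := by decide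

theorem exists_basis : ∀ d : V3, d ≠ 0 → ∃ u v : V3, dt v (cr d u) ≠ 0 := by decide

theorem exists_cr_eq : ∀ σ : V3, σ ≠ 0 → ∃ y y' z : V3, cr y y' = σ ∧ dt z σ = 1 ∧
    dt y σ = 0 ∧ dt y' σ = 0 := by decide

theorem dt_mul_dt (y y' l m : V3) :
    dt y l * dt y' m + dt y' l * dt y m = dt (cr y y') (cr l m) := by
  simp only [dt, cr, Matrix.cons_val]
  ring_nf
  reduce_mod_char

set_option maxRecDepth 100000 in
theorem dt_line_false : ∀ y y' l : V3, cr y y' ≠ 0 → dt y l = 0 → dt y' l = 0 →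
    dt y (th l) = 0 → dt y' (th l) = 0 → l = 0 := by decide

theorem sum_univ_V3 (n : V3 → ℕ) : ∑ c, n c = n ![0, 0, 0] + n ![1, 0, 0] + n ![0, 1, 0]
    + n ![0, 0, 1] + n ![1, 1, 0] + n ![1, 0, 1] + n ![0, 1, 1] + n ![1, 1, 1] := by
  have : (Finset.univ : Finset V3) = {![0, 0, 0], ![1, 0, 0], ![0, 1, 0], ![0, 0, 1],
    ![1, 1, 0], ![1, 0, 1], ![0, 1, 1], ![1, 1, 1]} := by decide
  rw [this]
  repeat rw [Finset.sum_insert (by decide)]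
  rw [Finset.sum_singleton]
  ring

set_option maxRecDepth 100000 in
set_option synthInstance.maxSize 1000 in
theorem comb_eq_zero : ∀ u v w c : V3, dt w (cr u v) ≠ 0 →
    c 0 • u + c 1 • v + c 2 • w = 0 → c = 0 := by decide

theorem sum_eq_of_basis (n : V3 → ℕ) (u v w : V3) (h : dt w (cr u v) ≠ 0) :
    ∑ c, n c = n 0 + n u + n v + n w + n (u + v) + n (u + w) + n (v + w) + n (u + v + w) := by
  let φ : V3 → V3 := fun c => c 0 • u + c 1 • v + c 2 • w
  have hφ : Function.Injective φ := by
    intro c c' hc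
    rw [← sub_eq_zero]
    refine comb_eq_zero u v w _ h ?_
    simp only [Pi.sub_apply, sub_smul]
    simp only [φ] at hc
    rw [← sub_eq_zero] at hc
    rw [← hc]; abel
  have hb : Function.Bijective φ := Finite.injective_iff_bijective.1 hφ
  rw [← Function.Bijective.sum_comp hb, sum_univ_V3]
  simp [φ]

set_option maxRecDepth 100000 in
set_option synthInstance.maxSize 1000 in
theorem mem_of_basis : ∀ u v w β : V3, dt w (cr u v) ≠ 0 → β = 0 ∨ β = u ∨ β = v ∨ β = w ∨
    β = u + v ∨ β = u + w ∨ β = v + w ∨ β = u + v + w := by decide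

theorem plane_all_eq_zero (R : V3 → V3) (hR : ∀ x y, R (x + y) = R x + R y) (u v w : V3)
    (h : dt w (cr u v) ≠ 0) (hu : R u = 0) (hv : R v = 0) (hw : R w = 0) (β : V3) : R β = 0 := by
  have h0 : R 0 = 0 := by have := hR 0 0; simpa using this
  rcases mem_of_basis u v w β h with rfl | rfl | rfl | rfl | rfl | rfl | rfl | rfl <;>
    simp [hR, hu, hv, hw, h0]

theorem isolated_ne_four {s t R : V3 → V3} {n : V3 → ℕ}
    (h4 : ∀ β, n β = 4 → R β = 0 → cr (s β) (t β) = 0)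
    (hn : ∀ β, n β ≤ 2 → s β = 0 ∧ t β = 0 ∧ R β = 0) (he : ∀ β, Even (n β))
    (β l : V3) (hl : l ≠ 0) (hs : s β = l) (ht : t β = th l) (hR : R β = 0) : 6 ≤ n β := by
  by_contra h
  rcases Nat.lt_or_ge 2 (n β) with h2 | h2
  · have : n β = 4 := by
      obtain ⟨k, hk⟩ := he β
      omega
    have := h4 β this hR
    rw [hs, ht] at this
    exact cr_th_ne_zero l hl this
  · obtain ⟨h1, -⟩ := hn β h2
    exact hl (hs ▸ h1)

set_option maxRecDepth 100000 in
set_option synthInstance.maxSize 1000 in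
theorem three_points_ne : ∀ u v w : V3, dt w (cr u v) ≠ 0 →
    u ≠ 0 ∧ cr u v ≠ 0 ∧ cr u w ≠ 0 ∧ cr v w ≠ 0 ∧ cr u v + cr (u + v) w ≠ 0 ∧
    cr u w ≠ cr v w ∧ cr u w ≠ cr u v + cr (u + v) w ∧ cr v w ≠ cr u v + cr (u + v) w ∧
    cr (cr u w) (cr v w) ≠ 0 ∧ cr (cr u w) (cr u v + cr (u + v) w) ≠ 0 ∧
    cr (cr v w) (cr u v + cr (u + v) w) ≠ 0 ∧
    cr (cr u w + cr v w) (cr u w + (cr u v + cr (u + v) w)) ≠ 0 := by decide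

set_option maxRecDepth 100000 in
set_option synthInstance.maxSize 1000 in
theorem four_cr_eq_zero_false : ∀ s t : V3, cr s t = 0 → ∀ w1 : V3, w1 ≠ 0 →
    cr (s + w1) (t + th w1) = 0 → ∀ w2 : V3, w2 ≠ 0 → w1 ≠ w2 →
    cr (s + w2) (t + th w2) = 0 → ∀ w3 : V3, w3 ≠ 0 → w1 ≠ w3 → w2 ≠ w3 →
    cr (s + w3) (t + th w3) = 0 → False := by decide

theorem dt_add_right (r a b : V3) : dt r (a + b) = dt r a + dt r b := by
  simp only [dt, Pi.add_apply]; ring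

theorem th_add (a b : V3) : th (a + b) = th a + th b := by
  revert a b; decide

theorem fibre_data_false (n : V3 → ℕ) (s t R : V3 → V3) (hsum : ∑ c, n c ≤ 24)
    (he : ∀ β, Even (n β))
    (hs : ∀ x y, s (x + y) = s x + s y + cr x y)
    (ht : ∀ x y, t (x + y) = t x + t y + th (cr x y))
    (hR : ∀ x y, R (x + y) = R x + R y)
    (hn : ∀ β, n β ≤ 2 → s β = 0 ∧ t β = 0 ∧ R β = 0)
    (h4s : ∀ β, n β = 4 → dt (R β) (s β) = 0) (h4t : ∀ β, n β = 4 → dt (R β) (t β) = 0)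
    (h4 : ∀ β, n β = 4 → R β = 0 → cr (s β) (t β) = 0)
    (hB : ∃ β, R β ≠ 0 ∨ 8 ≤ n β) (h0 : n 0 ≤ 2) (u : V3) (hu0 : u ≠ 0) (hu : n u ≤ 2) :
    False := by
  have hge : ∀ β, ¬ n β ≤ 2 → 4 ≤ n β := by
    intro β h
    obtain ⟨k, hk⟩ := he β
    omega
  obtain ⟨su, tu, Ru⟩ := hn u hu
  by_cases hv : ∃ v, n v ≤ 2 ∧ v ≠ 0 ∧ v ≠ u
  · obtain ⟨v, hv, hv0, hvu⟩ := hv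
    obtain ⟨sv, tv, Rv⟩ := hn v hv
    have huv := cr_ne_zero_of_ne u v hu0 hv0 hvu.symm
    have n6 := isolated_ne_four h4 hn he (u + v) (cr u v) huv (by rw [hs, su, sv]; simp)
      (by rw [ht, tu, tv]; simp) (by rw [hR, Ru, Rv]; simp)
    by_cases hw : ∃ w, n w ≤ 2 ∧ w ≠ 0 ∧ w ≠ u ∧ w ≠ v
    · obtain ⟨w, hw, hw0, hwu, hwv⟩ := hw
      have hb : dt w (cr u v) ≠ 0 := dt_ne_zero_of_notMem_plane u v w huv hw0 hwu hwv
        (by rintro rfl; omega)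
      obtain ⟨sw, tw, Rw⟩ := hn w hw
      obtain ⟨-, -, huw, hvw, huvw, -⟩ := three_points_ne u v w hb
      have m1 := isolated_ne_four h4 hn he (u + w) (cr u w) huw (by rw [hs, su, sw]; simp)
        (by rw [ht, tu, tw]; simp) (by rw [hR, Ru, Rw]; simp)
      have m2 := isolated_ne_four h4 hn he (v + w) (cr v w) hvw (by rw [hs, sv, sw]; simp)
        (by rw [ht, tv, tw]; simp) (by rw [hR, Rv, Rw]; simp)
      have m3 := isolated_ne_four h4 hn he (u + v + w) _ huvw (by rw [hs, hs, su, sv, sw]; simp)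
        (by rw [ht, ht, tu, tv, tw, th_add]; simp) (by rw [hR, hR, Ru, Rv, Rw]; simp)
      obtain ⟨β, hβ⟩ := hB
      rcases hβ with hβ | hβ
      · exact hβ (plane_all_eq_zero R hR u v w hb Ru Rv Rw β)
      · rw [sum_eq_of_basis n u v w hb] at hsum
        have key := mem_of_basis u v w β hb
        rcases key with rfl | rfl | rfl | rfl | rfl | rfl | rfl | rfl <;> omega
    · push Not at hw
      obtain ⟨w, hb⟩ := exists_dt_ne_zero _ huv
      obtain ⟨-, -, huw, hvw, huvw, n12, n13, n23, c12, c13, c23, c123⟩ := three_points_ne u v w hb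
      rw [sum_eq_of_basis n u v w hb] at hsum
      have hne : ∀ u v w : V3, dt w (cr u v) ≠ 0 → (w ≠ 0 ∧ w ≠ u ∧ w ≠ v) ∧
          (u + w ≠ 0 ∧ u + w ≠ u ∧ u + w ≠ v) ∧ (v + w ≠ 0 ∧ v + w ≠ u ∧ v + w ≠ v) ∧
          (u + v + w ≠ 0 ∧ u + v + w ≠ u ∧ u + v + w ≠ v) := by
        set_option maxRecDepth 100000 in
        set_option synthInstance.maxSize 1000 in
        decide
      obtain ⟨e1, e2, e3, e4⟩ := hne u v w hb
      have g : ∀ β, β ≠ 0 ∧ β ≠ u ∧ β ≠ v → 4 ≤ n β := by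
        rintro β ⟨h1, h2, h3⟩
        exact hge β fun h => h3 (hw β h h1 h2)
      have g1 := g _ e1
      have g2 := g _ e2
      have g3 := g _ e3
      have g4 := g _ e4
      have R2 : R (u + w) = R w := by rw [hR, Ru, zero_add]
      have R3 : R (v + w) = R w := by rw [hR, Rv, zero_add]
      have R4 : R (u + v + w) = R w := by rw [hR, hR, Ru, Rv, zero_add, zero_add]
      have s2 : s (u + w) = s w + cr u w := by rw [hs, su, zero_add]
      have s3 : s (v + w) = s w + cr v w := by rw [hs, sv, zero_add]
      have s4 : s (u + v + w) = s w + (cr u v + cr (u + v) w) := by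
        rw [hs, hs, su, sv]; abel
      have t2 : t (u + w) = t w + th (cr u w) := by rw [ht, tu, zero_add]
      have t3 : t (v + w) = t w + th (cr v w) := by rw [ht, tv, zero_add]
      have t4 : t (u + v + w) = t w + th (cr u v + cr (u + v) w) := by
        rw [ht, ht, tu, tv, th_add]; abel
      have q1 : n w = 4 → dt (R w) (s w) = 0 ∧ dt (R w) (t w) = 0 :=
        fun h => ⟨h4s _ h, h4t _ h⟩
      have q2 : n (u + w) = 4 → dt (R w) (s (u + w)) = 0 ∧ dt (R w) (t (u + w)) = 0 :=
        fun h => R2 ▸ ⟨h4s _ h, h4t _ h⟩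
      have q3 : n (v + w) = 4 → dt (R w) (s (v + w)) = 0 ∧ dt (R w) (t (v + w)) = 0 :=
        fun h => R3 ▸ ⟨h4s _ h, h4t _ h⟩
      have q4 : n (u + v + w) = 4 →
          dt (R w) (s (u + v + w)) = 0 ∧ dt (R w) (t (u + v + w)) = 0 :=
        fun h => R4 ▸ ⟨h4s _ h, h4t _ h⟩
      rw [s2, t2, dt_add_right _ (s w), dt_add_right _ (t w)] at q2
      rw [s3, t3, dt_add_right _ (s w), dt_add_right _ (t w)] at q3
      rw [s4, t4, dt_add_right _ (s w), dt_add_right _ (t w)] at q4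
      have Rw : R w = 0 := by
        have hthree : (n w = 4 ∧ n (u + w) = 4 ∧ n (v + w) = 4) ∨
            (n w = 4 ∧ n (u + w) = 4 ∧ n (u + v + w) = 4) ∨
            (n w = 4 ∧ n (v + w) = 4 ∧ n (u + v + w) = 4) ∨
            (n (u + w) = 4 ∧ n (v + w) = 4 ∧ n (u + v + w) = 4) := by
          have p1 := he w
          have p2 := he (u + w)
          have p3 := he (v + w)
          have p4 := he (u + v + w)
          rw [Nat.even_iff] at p1 p2 p3 p4
          omega
        rcases hthree with ⟨a, b, c⟩ | ⟨a, b, c⟩ | ⟨a, b, c⟩ | ⟨a, b, c⟩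
        · obtain ⟨a1, a2⟩ := q1 a
          obtain ⟨b1, b2⟩ := q2 b
          obtain ⟨d1, d2⟩ := q3 c
          rw [a1, zero_add] at b1 d1
          rw [a2, zero_add] at b2 d2
          exact eq_zero_of_dt_two _ _ _ c12 b1 d1 b2 d2
        · obtain ⟨a1, a2⟩ := q1 a
          obtain ⟨b1, b2⟩ := q2 b
          obtain ⟨d1, d2⟩ := q4 c
          rw [a1, zero_add] at b1 d1
          rw [a2, zero_add] at b2 d2
          exact eq_zero_of_dt_two _ _ _ c13 b1 d1 b2 d2
        · obtain ⟨a1, a2⟩ := q1 a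
          obtain ⟨b1, b2⟩ := q3 b
          obtain ⟨d1, d2⟩ := q4 c
          rw [a1, zero_add] at b1 d1
          rw [a2, zero_add] at b2 d2
          exact eq_zero_of_dt_two _ _ _ c23 b1 d1 b2 d2
        · obtain ⟨a1, a2⟩ := q2 a
          obtain ⟨b1, b2⟩ := q3 b
          obtain ⟨d1, d2⟩ := q4 c
          refine eq_zero_of_dt_two _ _ _ c123 ?_ ?_ ?_ ?_ <;>
            simp only [th_add, dt_add_right] at * <;> grind
      have hz := plane_all_eq_zero R hR u v w hb Ru Rv Rw
      obtain ⟨β, hβ⟩ := hB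
      rcases hβ with hβ | hβ
      · exact hβ (hz β)
      · have key := mem_of_basis u v w β hb
        have : n w = 4 ∧ n (u + w) = 4 ∧ n (v + w) = 4 ∧ n (u + v + w) = 4 := by
          rcases key with rfl | rfl | rfl | rfl | rfl | rfl | rfl | rfl <;> omega
        obtain ⟨a, b, c, d⟩ := this
        have A := h4 _ a (hz _)
        have B := h4 _ b (hz _)
        have C := h4 _ c (hz _)
        have D := h4 _ d (hz _)
        rw [s2, t2] at B
        rw [s3, t3] at C
        rw [s4, t4] at D
        exact four_cr_eq_zero_false _ _ A _ huw B _ hvw n12 C _ huvw n13 n23 D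
  · push Not at hv
    have g : ∀ β, β ≠ 0 ∧ β ≠ u → 4 ≤ n β := by
      rintro β ⟨h1, h2⟩
      exact hge β fun h => h2 (hv β h h1)
    obtain ⟨v, w, hb⟩ := exists_basis u hu0
    have hne : ∀ u v w : V3, dt w (cr u v) ≠ 0 → (v ≠ 0 ∧ v ≠ u) ∧ (w ≠ 0 ∧ w ≠ u) ∧
        (u + v ≠ 0 ∧ u + v ≠ u) ∧ (u + w ≠ 0 ∧ u + w ≠ u) ∧ (v + w ≠ 0 ∧ v + w ≠ u) ∧
        (u + v + w ≠ 0 ∧ u + v + w ≠ u) ∧ cr (cr u v) (cr u w) ≠ 0 := by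
      set_option maxRecDepth 100000 in
      set_option synthInstance.maxSize 1000 in
      decide
    obtain ⟨e1, e2, e3, e4, e5, e6, hc⟩ := hne u v w hb
    rw [sum_eq_of_basis n u v w hb] at hsum
    have g1 := g _ e1
    have g2 := g _ e2
    have g3 := g _ e3
    have g4 := g _ e4
    have g5 := g _ e5
    have g6 := g _ e6
    have line : ∀ y, n y = 4 → n (u + y) = 4 →
        dt (R y) (cr u y) = 0 ∧ dt (R y) (th (cr u y)) = 0 := by
      intro y hy hy'
      have a1 := h4s _ hy
      have a2 := h4t _ hy
      have b1 := h4s _ hy'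
      have b2 := h4t _ hy'
      rw [hR, Ru, zero_add, hs, su, zero_add, dt_add_right, a1, zero_add] at b1
      rw [hR, Ru, zero_add, ht, tu, zero_add, dt_add_right, a2, zero_add] at b2
      exact ⟨b1, b2⟩
    have cradd : cr u (v + w) = cr u v + cr u w := by
      ext i; fin_cases i <;> simp [cr] <;> ring
    obtain ⟨l1, l2⟩ := line v (by omega) (by omega)
    obtain ⟨l3, l4⟩ := line w (by omega) (by omega)
    obtain ⟨l5, l6⟩ := line (v + w) (by omega) (by rw [← add_assoc]; omega)
    rw [cradd, hR] at l5 l6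
    have Rv : R v = 0 := eq_zero_of_dt_pencil _ _ _ _ hc l1 l3 l2 l4 l5 l6
    have Rw : R w = 0 := by
      have c' : cr (cr u w) (cr u v) ≠ 0 := by
        have : ∀ a b : V3, cr a b = cr b a := by decide
        rwa [this]
      rw [add_comm (R v), add_comm (cr u v)] at l5 l6
      exact eq_zero_of_dt_pencil _ _ _ _ c' l3 l1 l4 l2 l5 l6
    obtain ⟨β, hβ⟩ := hB
    rcases hβ with hβ | hβ
    · exact hβ (plane_all_eq_zero R hR u v w hb Ru Rv Rw β)
    · have key := mem_of_basis u v w β hb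
      rcases key with rfl | rfl | rfl | rfl | rfl | rfl | rfl | rfl <;> omega

theorem exists_four_of_sum_le (n : V3 → ℕ) (hsum : ∑ c, n c ≤ 24) (he : ∀ β, Even (n β))
    (h2 : ∀ β, 2 ≤ n β) : ∃ a u v w : V3, n (a + 0) ≤ 2 ∧ n (a + u) ≤ 2 ∧ n (a + v) ≤ 2 ∧
      n (a + w) ≤ 2 ∧ u ≠ 0 ∧ v ≠ 0 ∧ u ≠ v ∧ w ≠ 0 ∧ w ≠ u ∧ w ≠ v := by
  have hcard : 4 ≤ (Finset.univ.filter fun β => n β ≤ 2).card := by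
    have h1 : ∀ β ∈ (Finset.univ : Finset V3), 4 ≤ n β + (if n β ≤ 2 then 2 else 0) := by
      intro β _
      obtain ⟨j, hj⟩ := he β
      have := h2 β
      split_ifs <;> omega
    have h3 := Finset.sum_le_sum h1
    rw [Finset.sum_add_distrib, ← Finset.sum_filter] at h3
    simp at h3
    omega
  obtain ⟨a, b, c, ha, hb, hc, hab, hac, hbc⟩ := Finset.two_lt_card_iff.1
    (lt_of_lt_of_le (by norm_num) hcard)
  obtain ⟨d, hd, hd'⟩ := Finset.exists_mem_notMem_of_card_lt_card
    (s := {a, b, c}) (lt_of_le_of_lt Finset.card_le_three (lt_of_lt_of_le (by norm_num) hcard))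
  simp only [Finset.mem_filter, Finset.mem_univ, true_and, Finset.mem_insert,
    Finset.mem_singleton, not_or] at ha hb hc hd hd'
  have e : ∀ a b : V3, a + (b - a) = b := fun a b => by abel
  refine ⟨a, b - a, c - a, d - a, by simpa, by rwa [e], by rwa [e], by rwa [e], ?_, ?_, ?_, ?_,
    ?_, ?_⟩ <;> simp only [ne_eq, sub_eq_zero, sub_left_inj] <;> tauto

theorem exists_two_of_sum_le (n : V3 → ℕ) (hsum : ∑ c, n c ≤ 24) (he : ∀ β, Even (n β)) :
    ∃ a u : V3, n (a + 0) ≤ 2 ∧ n (a + u) ≤ 2 ∧ u ≠ 0 := by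
  have hcard : 1 < (Finset.univ.filter fun β => n β ≤ 2).card := by
    have h1 : ∀ β ∈ (Finset.univ : Finset V3), 4 ≤ n β + (if n β ≤ 2 then 4 else 0) := by
      intro β _
      obtain ⟨j, hj⟩ := he β
      split_ifs <;> omega
    have h3 := Finset.sum_le_sum h1
    rw [Finset.sum_add_distrib, ← Finset.sum_filter] at h3
    simp at h3
    omega
  obtain ⟨a, ha, b, hb, hab⟩ := Finset.one_lt_card.1 hcard
  simp only [Finset.mem_filter, Finset.mem_univ, true_and] at ha hb
  refine ⟨a, b - a, by simpa, by rwa [show a + (b - a) = b by abel], ?_⟩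
  rw [ne_eq, sub_eq_zero]
  exact hab.symm

theorem cr_add_left (a b c : V3) : cr (a + b) c = cr a c + cr b c := by
  ext i; fin_cases i <;> simp [cr] <;> ring

theorem four_exact {G : Type*} [AddCommGroup G] (n : V3 → ℕ) (P M : V3 → G)
    (hM : ∀ l, l ≠ 0 → M l ≠ 0) (hMa : ∀ a b, M (a + b) = M a + M b)
    (hP : ∀ x y, P (x + y) = P x + P y + M (cr x y))
    (hn : ∀ β, n β ≤ 2 → P β = 0) (hsum : ∑ c, n c ≤ 24) (he : ∀ β, Even (n β))
    (h2 : ∀ β, 2 ≤ n β) (u v w : V3) (h0 : n 0 ≤ 2) (hu : n u ≤ 2) (hv : n v ≤ 2)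
    (hw : n w ≤ 2) (u0 : u ≠ 0) (v0 : v ≠ 0) (uv : u ≠ v) (w0 : w ≠ 0) (wu : w ≠ u)
    (wv : w ≠ v) :
    dt w (cr u v) ≠ 0 ∧ n (u + v) = 4 ∧ n (u + w) = 4 ∧ n (v + w) = 4 ∧ n (u + v + w) = 4 ∧
      P (u + v) = M (cr u v) ∧ P (u + w) = M (cr u w) ∧ P (v + w) = M (cr v w) ∧
      P (u + v + w) = M (cr u v + cr u w + cr v w) := by
  have Pu := hn u hu
  have Pv := hn v hv
  have Pw := hn w hw
  have huv := cr_ne_zero_of_ne u v u0 v0 uv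
  have P1 : P (u + v) = M (cr u v) := by rw [hP, Pu, Pv]; simp
  have P2 : P (u + w) = M (cr u w) := by rw [hP, Pu, Pw]; simp
  have P3 : P (v + w) = M (cr v w) := by rw [hP, Pv, Pw]; simp
  have P4 : P (u + v + w) = M (cr u v + cr u w + cr v w) := by
    rw [hP, P1, Pw, cr_add_left, add_zero, ← hMa, add_assoc]
  have ne : ∀ β l, l ≠ 0 → P β = M l → 4 ≤ n β := by
    intro β l hl h
    by_contra hlt
    refine hM l hl (h ▸ hn β ?_)
    obtain ⟨j, hj⟩ := he β
    omega
  have hb : dt w (cr u v) ≠ 0 := by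
    refine dt_ne_zero_of_notMem_plane u v w huv w0 wu wv ?_
    rintro rfl
    have := ne _ _ huv P1
    omega
  obtain ⟨-, -, huw, hvw, huvw, -⟩ := three_points_ne u v w hb
  rw [cr_add_left, ← add_assoc] at huvw
  have m1 := ne _ _ huv P1
  have m2 := ne _ _ huw P2
  have m3 := ne _ _ hvw P3
  have m4 := ne _ _ huvw P4
  rw [sum_eq_of_basis n u v w hb] at hsum
  have k0 := h2 0
  have k1 := h2 u
  have k2 := h2 v
  have k3 := h2 w
  refine ⟨hb, ?_, ?_, ?_, ?_, P1, P2, P3, P4⟩ <;> omega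

theorem fs_add {ι : Type*} (S : Finset ι) (b : ι → V3) (g : ι → ZMod 2) (c : V3)
    (h0 : ∑ x ∈ S, g x = 0) (h1 : ∀ j, ∑ x ∈ S, g x * b x j = c j) (a : V3)
    (ha : fs S b g a = 0) (x y : V3) :
    fs S b g (a + (x + y)) = fs S b g (a + x) + fs S b g (a + y) + dt (cr x y) c := by
  have self : ∀ x : V3, x + x = 0 := fun x => by
    ext i; exact CharTwo.add_self_eq_zero _
  have crself : ∀ x : V3, cr x x = 0 := by decide
  have cr0 : ∀ x : V3, cr x 0 = 0 := by decide
  have cr0' : ∀ x : V3, cr 0 x = 0 := by decide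
  have dt0 : ∀ c : V3, dt 0 c = 0 := by decide
  by_cases hxy : cr x y = 0
  · have : x = 0 ∨ y = 0 ∨ x = y := by
      by_contra hcon
      push Not at hcon
      exact cr_ne_zero_of_ne x y hcon.1 hcon.2.1 hcon.2.2 hxy
    rcases this with rfl | rfl | rfl
    · simp [ha, cr0', dt0]
    · simp [ha, cr0, dt0]
    · rw [self, add_zero, ha, crself, dt0, zmod2_add_self, add_zero]
  · have := fs_plane S b g c h0 h1 a x y hxy
    rw [ha, zero_add] at this
    rw [← this]
    linear_combination (-1 : ZMod 2) * zmod2_add_self (fs S b g (a + x) + fs S b g (a + y))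

/-- Moment conditions on a finite family of points `(p, q, k, b)` of `𝔽₂ ⊕ 𝔽₂ ⊕ 𝔽₂³ ⊕ 𝔽₂³`. -/
structure Moments {ι : Type*} (S : Finset ι) (p q : ι → ZMod 2) (k b : ι → V3) : Prop where
  card : (S.card : ZMod 2) = 0
  sp : ∑ x ∈ S, p x = 0
  sq : ∑ x ∈ S, q x = 0
  sk : ∀ i, ∑ x ∈ S, k x i = 0
  sb : ∀ i, ∑ x ∈ S, b x i = 0
  bb : ∀ i j, ∑ x ∈ S, b x i * b x j = 0
  bbb : ∑ x ∈ S, b x 0 * b x 1 * b x 2 = 0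
  pb : ∀ j, ∑ x ∈ S, p x * b x j = 0
  qb : ∀ j, ∑ x ∈ S, q x * b x j = 0
  kb : ∀ i j, ∑ x ∈ S, k x i * b x j = 0
  pbb : ∀ i j, ∑ x ∈ S, p x * b x i * b x j = 0
  qbb : ∀ i j, ∑ x ∈ S, q x * b x i * b x j = 0
  kbb : ∀ l i j, ∑ x ∈ S, k x l * b x i * b x j = 0
  kk : ∀ i j, ∑ x ∈ S, k x i * k x j = 0
  kkb : ∀ i j l, ∑ x ∈ S, k x i * k x j * b x l = 0
  pk : ∀ i, ∑ x ∈ S, p x * k x i = 0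
  qk : ∀ i, ∑ x ∈ S, q x * k x i = 0
  pkb : ∀ i j, ∑ x ∈ S, p x * k x i * b x j = (Pi.single i 1 : V3) j
  qkb : ∀ i j, ∑ x ∈ S, q x * k x i * b x j = th (Pi.single j 1) i
  kkk : ∑ x ∈ S, k x 0 * k x 1 * k x 2 = 1

theorem dt_single (l : V3) (i : Fin 3) : dt l (Pi.single i 1) = l i := by
  revert l i; decide

theorem dt_th_single (l : V3) (i : Fin 3) :
    dt l (fun j => th (Pi.single j 1) i) = th l i := by
  revert l i; decide

namespace Moments

variable {ι : Type*} {S : Finset ι} {p q : ι → ZMod 2} {k b : ι → V3}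

theorem even_card_fibre (h : Moments S p q k b) (β : V3) :
    ((S.filter fun x => b x = β).card : ZMod 2) = 0 := by
  have := fs_eq_top S b (fun _ => 1) (by simpa using h.card) (by simpa using h.sb)
    (by simpa using h.bb) β
  simp only [fs, Finset.sum_const, nsmul_eq_mul, mul_one, one_mul, h.bbb] at this
  exact this

theorem even_card_fibre' (h : Moments S p q k b) (β : V3) :
    Even (S.filter fun x => b x = β).card :=
  (ZMod.natCast_eq_zero_iff_even).1 (h.even_card_fibre β)

theorem sum_card_fibre : ∑ β, (S.filter fun x => b x = β).card = S.card :=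
  (Finset.card_eq_sum_card_fiberwise (fun _ _ => Finset.mem_coe.2 (Finset.mem_univ _))).symm

theorem sum_card_fibre_add (a : V3) :
    ∑ β, (S.filter fun x => b x = a + β).card = S.card := by
  rw [← sum_card_fibre (S := S) (b := b)]
  exact Equiv.sum_comp (Equiv.addLeft a) fun β => (S.filter fun x => b x = β).card

/-- The sum of `k i * k j` over a fibre, as the vector indexed by the complementary index. -/
def R (S : Finset ι) (k b : ι → V3) (β : V3) : V3 :=
  ![fs S b (fun x => k x 1 * k x 2) β, fs S b (fun x => k x 0 * k x 2) β,
    fs S b (fun x => k x 0 * k x 1) β]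

theorem R_add (h : Moments S p q k b) (a : V3) (ha : R S k b a = 0) (x y : V3) :
    R S k b (a + (x + y)) = R S k b (a + x) + R S k b (a + y) := by
  have dt0 : ∀ c : V3, dt c 0 = 0 := by decide
  have key : ∀ i j, fs S b (fun x => k x i * k x j) a = 0 →
      fs S b (fun x => k x i * k x j) (a + (x + y)) = fs S b (fun x => k x i * k x j) (a + x)
        + fs S b (fun x => k x i * k x j) (a + y) := by
    intro i j h'
    rw [fs_add S b _ 0 (h.kk i j) (by simpa using h.kkb i j) a h', dt0, add_zero]
  ext i
  have hi := congrFun ha i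
  fin_cases i <;> exact key _ _ hi

theorem exists_fibre (h : Moments S p q k b) (hk : ∀ i β, fs S b (fun x => k x i) β = 0) :
    ∃ β, R S k b β ≠ 0 ∨ 8 ≤ (S.filter fun x => b x = β).card := by
  by_contra hcon
  push Not at hcon
  have hz : ∀ β, ∑ x ∈ S with b x = β, k x 0 * k x 1 * k x 2 = 0 := by
    intro β
    obtain ⟨hR, h8⟩ := hcon β
    refine sum_triple_eq_zero_of_card_lt_eight _ h8 (h.even_card_fibre β) k (fun i => hk i β) ?_
    have r0 : fs S b (fun x => k x 1 * k x 2) β = 0 := congrFun hR 0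
    have r1 : fs S b (fun x => k x 0 * k x 2) β = 0 := congrFun hR 1
    have r2 : fs S b (fun x => k x 0 * k x 1) β = 0 := congrFun hR 2
    have sqr : ∀ a : ZMod 2, a * a = a := by decide
    intro i j
    have hki := hk i β
    fin_cases i <;> fin_cases j <;>
      first
        | exact r0
        | exact r1
        | exact r2
        | (simp only [sqr]; exact hki)
        | (refine Eq.trans (Finset.sum_congr rfl fun x _ => mul_comm _ _) ?_
           first
            | exact r0
            | exact r1
            | exact r2)
  have := h.kkk
  rw [← Finset.sum_fiberwise S b, Finset.sum_eq_zero fun β _ => hz β] at this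
  exact zero_ne_one this

/-- The Pfaffian relation on a fibre of size four, for one function against `k`. -/
theorem dt_R_eq_zero (g : ι → ZMod 2) (β : V3) (h4 : (S.filter fun x => b x = β).card = 4)
    (hg : fs S b g β = 0) (hk : ∀ i, fs S b (fun x => k x i) β = 0) :
    dt (R S k b β) (fun i => fs S b (fun x => g x * k x i) β) = 0 := by
  have := pfaffian_of_card_eq_four _ h4 ![g, fun x => k x 0, fun x => k x 1, fun x => k x 2]
    (by intro i; fin_cases i <;> [exact hg; exact hk 0; exact hk 1; exact hk 2])
  simp only [Matrix.cons_val] at this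
  simp only [dt, R, fs, Matrix.cons_val]
  linear_combination this

theorem cr_eq_zero (g g' : ι → ZMod 2) (β : V3) (h4 : (S.filter fun x => b x = β).card = 4)
    (hg : fs S b g β = 0) (hg' : fs S b g' β = 0) (hk : ∀ i, fs S b (fun x => k x i) β = 0)
    (hR : R S k b β = 0) :
    cr (fun i => fs S b (fun x => g x * k x i) β) (fun i => fs S b (fun x => g' x * k x i) β)
      = 0 := by
  have key : ∀ i j, fs S b (fun x => k x i * k x j) β = 0 →
      fs S b (fun x => g x * k x i) β * fs S b (fun x => g' x * k x j) β +
      fs S b (fun x => g x * k x j) β * fs S b (fun x => g' x * k x i) β = 0 := by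
    intro i j hij
    have := pfaffian_of_card_eq_four _ h4 ![g, g', fun x => k x i, fun x => k x j]
      (by intro i; fin_cases i <;> [exact hg; exact hg'; exact hk _; exact hk _])
    simp only [Matrix.cons_val] at this
    simp only [fs] at hij ⊢
    rw [hij, mul_zero, zero_add] at this
    linear_combination this
  have k0 := key 1 2 (congrFun hR 0)
  have k1 := key 0 2 (congrFun hR 1)
  have k2 := key 0 1 (congrFun hR 2)
  ext i
  fin_cases i
  · exact k0
  · rw [add_comm] at k1; exact k1
  · exact k2

theorem s_add (h : Moments S p q k b) (a : V3)
    (ha : (fun i => fs S b (fun x => p x * k x i) a) = (0 : V3)) (x y : V3) :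
    (fun i => fs S b (fun x => p x * k x i) (a + (x + y)) : V3) =
      (fun i => fs S b (fun x => p x * k x i) (a + x)) +
      (fun i => fs S b (fun x => p x * k x i) (a + y)) + cr x y := by
  ext i
  rw [fs_add S b _ _ (h.pk i) (h.pkb i) a (congrFun ha i), dt_single]
  rfl

theorem t_add (h : Moments S p q k b) (a : V3)
    (ha : (fun i => fs S b (fun x => q x * k x i) a) = (0 : V3)) (x y : V3) :
    (fun i => fs S b (fun x => q x * k x i) (a + (x + y)) : V3) =
      (fun i => fs S b (fun x => q x * k x i) (a + x)) +
      (fun i => fs S b (fun x => q x * k x i) (a + y)) + th (cr x y) := by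
  ext i
  rw [fs_add S b _ _ (h.qk i) (h.qkb i) a (congrFun ha i), dt_th_single]
  rfl

theorem pair_eq_zero (h : Moments S p q k b) (β : V3)
    (h2 : (S.filter fun x => b x = β).card ≤ 2) (f g : ι → ZMod 2) (hf : fs S b f β = 0)
    (hg : fs S b g β = 0) : fs S b (fun x => f x * g x) β = 0 :=
  sum_mul_eq_zero_of_card_le_two _ h2 (h.even_card_fibre β) f g hf hg

theorem R_eq_zero (h : Moments S p q k b) (β : V3)
    (h2 : (S.filter fun x => b x = β).card ≤ 2) (hk : ∀ i, fs S b (fun x => k x i) β = 0) :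
    R S k b β = 0 := by
  ext i
  fin_cases i
  · exact h.pair_eq_zero β h2 _ _ (hk 1) (hk 2)
  · exact h.pair_eq_zero β h2 _ _ (hk 0) (hk 2)
  · exact h.pair_eq_zero β h2 _ _ (hk 0) (hk 1)

theorem false_of_all_zero (h : Moments S p q k b) (hS : S.card ≤ 24)
    (hp : ∀ β, fs S b p β = 0) (hq : ∀ β, fs S b q β = 0)
    (hk : ∀ i β, fs S b (fun x => k x i) β = 0) : False := by
  obtain ⟨a, u, ha, hu, hu0⟩ := exists_two_of_sum_le
    (fun β => (S.filter fun x => b x = β).card) (by rw [sum_card_fibre]; exact hS)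
    h.even_card_fibre'
  have small : ∀ β, (S.filter fun x => b x = β).card ≤ 2 →
      (fun i => fs S b (fun x => p x * k x i) β) = (0 : V3) ∧
      (fun i => fs S b (fun x => q x * k x i) β) = (0 : V3) ∧ R S k b β = 0 := fun β hβ =>
    ⟨funext fun i => h.pair_eq_zero β hβ _ _ (hp β) (hk i β),
      funext fun i => h.pair_eq_zero β hβ _ _ (hq β) (hk i β),
      h.R_eq_zero β hβ fun i => hk i β⟩
  obtain ⟨s0, t0, R0⟩ := small _ ha
  rw [add_zero] at s0 t0 R0
  refine fibre_data_false (fun β => (S.filter fun x => b x = a + β).card)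
    (fun β i => fs S b (fun x => p x * k x i) (a + β))
    (fun β i => fs S b (fun x => q x * k x i) (a + β))
    (fun β => R S k b (a + β)) (by rw [sum_card_fibre_add]; exact hS)
    (fun β => h.even_card_fibre' _) (h.s_add a s0) (h.t_add a t0) (h.R_add a R0)
    (fun β => small _) (fun β h4 => dt_R_eq_zero p _ h4 (hp _) fun i => hk i _)
    (fun β h4 => dt_R_eq_zero q _ h4 (hq _) fun i => hk i _)
    (fun β h4 hR => cr_eq_zero p q _ h4 (hp _) (hq _) (fun i => hk i _) hR) ?_ ha u hu0 hu
  obtain ⟨β, hβ⟩ := h.exists_fibre hk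
  refine ⟨β - a, ?_⟩
  rwa [show a + (β - a) = β by abel]

theorem two_le_card_of_fs_ne_zero (h : Moments S p q k b) (β : V3) (g : ι → ZMod 2)
    (hg : fs S b g β ≠ 0) : 2 ≤ (S.filter fun x => b x = β).card := by
  obtain ⟨x, hx, -⟩ := Finset.exists_ne_zero_of_sum_ne_zero hg
  have := Finset.card_pos.2 ⟨x, hx⟩
  obtain ⟨j, hj⟩ := h.even_card_fibre' β
  omega

theorem false_of_k_zero (h : Moments S p q k b) (hS : S.card ≤ 24) (σ1 σ2 : ZMod 2)
    (hp : ∀ β, fs S b p β = σ1) (hq : ∀ β, fs S b q β = σ2)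
    (hk : ∀ i β, fs S b (fun x => k x i) β = 0) (hσ : σ1 ≠ 0 ∨ σ2 ≠ 0) : False := by
  have h2 : ∀ β, 2 ≤ (S.filter fun x => b x = β).card := by
    intro β
    rcases hσ with hσ | hσ
    · exact h.two_le_card_of_fs_ne_zero β p (by rwa [hp])
    · exact h.two_le_card_of_fs_ne_zero β q (by rwa [hq])
  obtain ⟨a, u, v, w, ha, hu, hv, hw, u0, v0, uv, w0, wu, wv⟩ := exists_four_of_sum_le
    (fun β => (S.filter fun x => b x = β).card) (by rw [sum_card_fibre]; exact hS)
    h.even_card_fibre' h2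
  let g : ι → ZMod 2 := fun x => σ2 * p x + σ1 * q x
  have hg : ∀ β, fs S b g β = 0 := by
    intro β
    have e : fs S b g β = σ2 * fs S b p β + σ1 * fs S b q β := by
      simp only [fs, g, Finset.sum_add_distrib, Finset.mul_sum]
    rw [e, hp, hq]
    linear_combination zmod2_add_self (σ1 * σ2)
  have gz : ∀ β, (S.filter fun x => b x = β).card ≤ 2 →
      ∀ i, fs S b (fun x => g x * k x i) β = 0 := fun β hβ i =>
    h.pair_eq_zero β hβ _ _ (hg β) (hk i β)
  have R0 := h.R_eq_zero _ ha fun i => hk i _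
  rw [add_zero] at R0
  let M : V3 → V3 := fun l => σ2 • l + σ1 • th l
  have hM : ∀ l, l ≠ 0 → M l ≠ 0 := by
    have : ∀ σ1 σ2 : ZMod 2, (σ1 ≠ 0 ∨ σ2 ≠ 0) → ∀ l : V3, l ≠ 0 → σ2 • l + σ1 • th l ≠ 0 := by
      decide
    exact this σ1 σ2 hσ
  have hMa : ∀ a b, M (a + b) = M a + M b := by
    intro a b
    simp only [M, th_add, smul_add]; abel
  have hP : ∀ x y : V3, (fun i => fs S b (fun x => g x * k x i) (a + (x + y)) : V3) =
      (fun i => fs S b (fun x => g x * k x i) (a + x)) +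
      (fun i => fs S b (fun x => g x * k x i) (a + y)) + M (cr x y) := by
    intro x y
    ext i
    rw [fs_add S b _ (σ2 • Pi.single i 1 + σ1 • fun j => th (Pi.single j 1) i) ?_ ?_ a
      (by simpa using gz _ ha i)]
    · have dts : ∀ (l c d : V3), dt l (σ2 • c + σ1 • d) = σ2 * dt l c + σ1 * dt l d := by
        intro l c d
        simp only [dt, Pi.add_apply, Pi.smul_apply, smul_eq_mul]; ring
      rw [dts, dt_single, dt_th_single]
      rfl
    · simp only [g, add_mul, Finset.sum_add_distrib, mul_assoc, ← Finset.mul_sum, h.pk, h.qk]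
      simp
    · intro j
      have e1 := h.pkb i j
      have e2 := h.qkb i j
      simp only [mul_assoc] at e1 e2
      simp only [g, add_mul, Finset.sum_add_distrib, mul_assoc, ← Finset.mul_sum, e1, e2]
      rfl
  obtain ⟨hb, n1, n2, n3, n4, -⟩ := four_exact
    (fun β => (S.filter fun x => b x = a + β).card)
    (fun β i => fs S b (fun x => g x * k x i) (a + β)) M hM hMa hP
    (fun β hβ => funext fun i => gz _ hβ i) (by rw [sum_card_fibre_add]; exact hS)
    (fun β => h.even_card_fibre' _) (fun β => h2 _) u v w ha hu hv hw u0 v0 uv w0 wu wv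
  obtain ⟨β, hβ⟩ := h.exists_fibre hk
  obtain ⟨β, rfl⟩ : ∃ γ, β = a + γ := ⟨β - a, by abel⟩
  rcases hβ with hβ | hβ
  · exact hβ (plane_all_eq_zero (fun β => R S k b (a + β)) (h.R_add a R0) u v w hb
      (h.R_eq_zero _ hu fun i => hk i _) (h.R_eq_zero _ hv fun i => hk i _)
      (h.R_eq_zero _ hw fun i => hk i _) β)
  · rcases mem_of_basis u v w β hb with rfl | rfl | rfl | rfl | rfl | rfl | rfl | rfl <;>
      omega

theorem dt_sum (y : V3) (f : ι → V3) (T : Finset ι) :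
    ∑ x ∈ T, dt y (f x) = dt y (fun i => ∑ x ∈ T, f x i) := by
  simp only [dt, Finset.sum_add_distrib, Finset.mul_sum]

theorem false_of_k_ne_zero (h : Moments S p q k b) (hS : S.card ≤ 24) (σ1 σ2 : ZMod 2) (σ : V3)
    (hp : ∀ β, fs S b p β = σ1) (hq : ∀ β, fs S b q β = σ2)
    (hk : ∀ i β, fs S b (fun x => k x i) β = σ i) (hσ : σ ≠ 0) : False := by
  have h2 : ∀ β, 2 ≤ (S.filter fun x => b x = β).card := by
    intro β
    obtain ⟨i, hi⟩ := Function.ne_iff.1 hσ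
    exact h.two_le_card_of_fs_ne_zero β _ (by rw [hk i]; exact hi)
  obtain ⟨a, u, v, w, ha, hu, hv, hw, u0, v0, uv, w0, wu, wv⟩ := exists_four_of_sum_le
    (fun β => (S.filter fun x => b x = β).card) (by rw [sum_card_fibre]; exact hS)
    h.even_card_fibre' h2
  obtain ⟨y, y', z, hyy, hz, hy, hy'⟩ := exists_cr_eq σ hσ
  have fdt : ∀ (y : V3) β, fs S b (fun x => dt y (k x)) β = dt y σ := by
    intro y β
    rw [fs, dt_sum]
    congr 1
    ext i; exact hk i β
  have kz : ∀ i, ∑ x ∈ S, k x i = 0 := h.sk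
  have lift : ∀ (g : ι → ZMod 2) (τ : ZMod 2), (∀ β, fs S b g β = τ) → ∀ β,
      fs S b (fun x => g x + τ * dt z (k x)) β = 0 := by
    intro g τ hg β
    have e : fs S b (fun x => g x + τ * dt z (k x)) β = fs S b g β
        + τ * fs S b (fun x => dt z (k x)) β := by
      simp only [fs, Finset.sum_add_distrib, Finset.mul_sum]
    rw [e, hg, fdt, hz, mul_one, zmod2_add_self]
  have e0 : ∀ (g : ι → ZMod 2) (τ : ZMod 2) (y : V3), (∀ i, ∑ x ∈ S, g x * k x i = 0) →
      ∑ x ∈ S, (g x + τ * dt z (k x)) * dt y (k x) = 0 := by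
    intro g τ y hg
    have : ∀ x, (g x + τ * dt z (k x)) * dt y (k x) = y 0 * (g x * k x 0) + y 1 * (g x * k x 1)
        + y 2 * (g x * k x 2) + τ * (∑ i, ∑ j, z i * y j * (k x i * k x j)) := by
      intro x
      simp only [dt, Fin.sum_univ_three]; ring
    simp only [this, Finset.sum_add_distrib, ← Finset.mul_sum, hg]
    rw [Finset.sum_comm]
    simp only [Finset.sum_comm (s := S), ← Finset.mul_sum, h.kk]
    simp
  have e1 : ∀ (g : ι → ZMod 2) (τ : ZMod 2) (y : V3) (j : Fin 3),
      ∑ x ∈ S, (g x + τ * dt z (k x)) * dt y (k x) * b x j =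
        dt y (fun i => ∑ x ∈ S, g x * k x i * b x j) := by
    intro g τ y j
    have : ∀ x, (g x + τ * dt z (k x)) * dt y (k x) * b x j =
        dt y (fun i => g x * k x i * b x j)
        + τ * (∑ i, ∑ i', z i * y i' * (k x i * k x i' * b x j)) := by
      intro x
      simp only [dt, Fin.sum_univ_three]; ring
    simp only [this, Finset.sum_add_distrib, ← Finset.mul_sum, dt_sum]
    rw [Finset.sum_comm]
    simp only [Finset.sum_comm (s := S), ← Finset.mul_sum, h.kkb]
    simp
  have kk0 : ∀ y y' : V3, ∑ x ∈ S, dt y (k x) * dt y' (k x) = 0 := by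
    intro y y'
    have : ∀ x, dt y (k x) * dt y' (k x) = ∑ i, ∑ j, y i * y' j * (k x i * k x j) := by
      intro x
      simp only [dt, Fin.sum_univ_three]; ring
    simp only [this, Finset.sum_comm (s := S), ← Finset.mul_sum, h.kk]
    simp
  have kk1 : ∀ (y y' : V3) (j : Fin 3),
      ∑ x ∈ S, dt y (k x) * dt y' (k x) * b x j = (0 : V3) j := by
    intro y y' j
    have : ∀ x, dt y (k x) * dt y' (k x) * b x j =
        ∑ i, ∑ i', y i * y' i' * (k x i * k x i' * b x j) := by
      intro x
      simp only [dt, Fin.sum_univ_three]; ring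
    simp only [this, Finset.sum_comm (s := S), ← Finset.mul_sum, h.kkb]
    simp
  let p' : ι → ZMod 2 := fun x => p x + σ1 * dt z (k x)
  let q' : ι → ZMod 2 := fun x => q x + σ2 * dt z (k x)
  have hp' := lift p σ1 hp
  have hq' := lift q σ2 hq
  have hyk : ∀ β, fs S b (fun x => dt y (k x)) β = 0 := fun β => (fdt y β).trans hy
  have hyk' : ∀ β, fs S b (fun x => dt y' (k x)) β = 0 := fun β => (fdt y' β).trans hy'
  have pQ : ∀ y, dt y σ = 0 → ∀ l m : V3, fs S b (fun x => p' x * dt y (k x)) (a + (l + m)) =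
      fs S b (fun x => p' x * dt y (k x)) (a + l) + fs S b (fun x => p' x * dt y (k x)) (a + m)
      + dt y (cr l m) := by
    intro y hy l m
    have dtc : ∀ y c : V3, dt y c = dt c y := by decide
    rw [dtc y]
    refine fs_add S b _ y (e0 p σ1 y h.pk) ?_ a ?_ l m
    · intro j
      rw [e1]
      simp only [h.pkb]
      clear hy
      revert y j; decide
    · rw [add_zero] at ha
      exact h.pair_eq_zero a ha _ _ (hp' a) ((fdt y a).trans hy)
  have qQ : ∀ y, dt y σ = 0 → ∀ l m : V3, fs S b (fun x => q' x * dt y (k x)) (a + (l + m)) =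
      fs S b (fun x => q' x * dt y (k x)) (a + l) + fs S b (fun x => q' x * dt y (k x)) (a + m)
      + dt y (th (cr l m)) := by
    intro y hy l m
    have dtc : ∀ y c : V3, dt y (th c) = dt c (fun j => dt y (th (Pi.single j 1))) := by decide
    rw [dtc y]
    refine fs_add S b _ _ (e0 q σ2 y h.qk) ?_ a ?_ l m
    · intro j
      rw [e1]
      simp only [h.qkb]
    · rw [add_zero] at ha
      exact h.pair_eq_zero a ha _ _ (hq' a) ((fdt y a).trans hy)
  let P : V3 → ZMod 2 × ZMod 2 × ZMod 2 × ZMod 2 := fun β =>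
    (fs S b (fun x => p' x * dt y (k x)) (a + β), fs S b (fun x => p' x * dt y' (k x)) (a + β),
      fs S b (fun x => q' x * dt y (k x)) (a + β), fs S b (fun x => q' x * dt y' (k x)) (a + β))
  let M : V3 → ZMod 2 × ZMod 2 × ZMod 2 × ZMod 2 := fun l =>
    (dt y l, dt y' l, dt y (th l), dt y' (th l))
  have hM : ∀ l, l ≠ 0 → M l ≠ 0 := by
    intro l hl hMl
    simp only [M, Prod.mk_eq_zero] at hMl
    obtain ⟨m1, m2, m3, m4⟩ := hMl
    exact hl (dt_line_false y y' l (by rwa [hyy]) m1 m2 m3 m4)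
  have hMa : ∀ a b, M (a + b) = M a + M b := by
    intro a b
    simp only [M, th_add, dt_add_right, Prod.mk_add_mk]
  have hP : ∀ l m, P (l + m) = P l + P m + M (cr l m) := by
    intro l m
    simp only [P, M, Prod.mk_add_mk]
    rw [pQ y hy, pQ y' hy', qQ y hy, qQ y' hy']
  have hPz : ∀ β, (S.filter fun x => b x = a + β).card ≤ 2 → P β = 0 := by
    intro β hβ
    simp only [P, Prod.mk_eq_zero]
    exact ⟨h.pair_eq_zero _ hβ _ _ (hp' _) (hyk _), h.pair_eq_zero _ hβ _ _ (hp' _) (hyk' _),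
      h.pair_eq_zero _ hβ _ _ (hq' _) (hyk _), h.pair_eq_zero _ hβ _ _ (hq' _) (hyk' _)⟩
  obtain ⟨hb, n1, n2, n3, n4, P1, P2, P3, P4⟩ := four_exact
    (fun β => (S.filter fun x => b x = a + β).card) P M hM hMa hP hPz
    (by rw [sum_card_fibre_add]; exact hS)
    (fun β => h.even_card_fibre' _) (fun β => h2 _) u v w ha hu hv hw u0 v0 uv w0 wu wv
  have yyz : ∀ β, (S.filter fun x => b x = a + β).card ≤ 2 →
      fs S b (fun x => dt y (k x) * dt y' (k x)) (a + β) = 0 :=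
    fun β hβ => h.pair_eq_zero _ hβ _ _ (hyk _) (hyk' _)
  have dt0 : ∀ c : V3, dt c 0 = 0 := by decide
  have yya : ∀ l m : V3, fs S b (fun x => dt y (k x) * dt y' (k x)) (a + (l + m)) =
      fs S b (fun x => dt y (k x) * dt y' (k x)) (a + l)
      + fs S b (fun x => dt y (k x) * dt y' (k x)) (a + m) := by
    intro l m
    rw [fs_add S b _ 0 (kk0 y y') (kk1 y y') a (by simpa using yyz 0 ha) l m, dt0, add_zero]
  have pf : ∀ β l, (S.filter fun x => b x = a + β).card = 4 →
      fs S b (fun x => dt y (k x) * dt y' (k x)) (a + β) = 0 → P β = M l →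
      dt σ (cr l (th l)) = 0 := by
    intro β l h4 hyz hPM
    have := pfaffian_of_card_eq_four _ h4 ![p', q', fun x => dt y (k x), fun x => dt y' (k x)]
      (by intro i; fin_cases i <;> [exact hp' _; exact hq' _; exact hyk _; exact hyk' _])
    simp only [Matrix.cons_val] at this
    simp only [P, M, Prod.mk.injEq, fs] at hPM hyz
    obtain ⟨m1, m2, m3, m4⟩ := hPM
    rw [hyz, m1, m2, m3, m4] at this
    rw [← hyy, ← dt_mul_dt]
    linear_combination this
  have yu := yyz u hu
  have yv := yyz v hv
  have yw := yyz w hw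
  have f1 := pf _ _ n1 (by rw [yya, yu, yv, add_zero]) P1
  have f2 := pf _ _ n2 (by rw [yya, yu, yw, add_zero]) P2
  have f3 := pf _ _ n3 (by rw [yya, yv, yw, add_zero]) P3
  have f4 := pf _ _ n4 (by rw [yya, yya, yu, yv, yw, add_zero, add_zero]) P4
  have hb' : ∀ u v w : V3, dt w (cr u v) ≠ 0 → dt (cr u v) (cr (cr u w) (cr v w)) ≠ 0 := by
    set_option maxRecDepth 100000 in
    set_option synthInstance.maxSize 1000 in
    decide
  exact hσ (eq_zero_of_dt_frame _ _ _ σ (hb' u v w hb) f1 f2 f3 f4)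

theorem card_ge (h : Moments S p q k b) : 26 ≤ S.card := by
  by_contra hlt
  have hS : S.card ≤ 24 := by
    obtain ⟨j, hj⟩ := (ZMod.natCast_eq_zero_iff_even).1 h.card
    omega
  have hp := fs_eq_top S b p h.sp h.pb h.pbb
  have hq := fs_eq_top S b q h.sq h.qb h.qbb
  have hk := fun i => fs_eq_top S b (fun x => k x i) (h.sk i) (h.kb i) (h.kbb i)
  set σ1 := ∑ x ∈ S, p x * b x 0 * b x 1 * b x 2
  set σ2 := ∑ x ∈ S, q x * b x 0 * b x 1 * b x 2
  set σ : V3 := fun i => ∑ x ∈ S, k x i * b x 0 * b x 1 * b x 2 with hσ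
  by_cases h0 : σ = 0
  · have hk0 : ∀ i β, fs S b (fun x => k x i) β = 0 := fun i β =>
      (hk i β).trans (congrFun h0 i)
    by_cases h1 : σ1 = 0
    · by_cases h2 : σ2 = 0
      · exact h.false_of_all_zero hS (fun β => (hp β).trans h1) (fun β => (hq β).trans h2) hk0
      · exact h.false_of_k_zero hS σ1 σ2 hp hq hk0 (Or.inr h2)
    · exact h.false_of_k_zero hS σ1 σ2 hp hq hk0 (Or.inl h1)
  · exact h.false_of_k_ne_zero hS σ1 σ2 σ hp hq (fun i β => hk i β) h0

end Moments

/-- The moments of order at most two of `S` vanish, and those of order three are given by `t`. -/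
structure Realizes {m : ℕ} (t : Finset (Fin m) → ZMod 2) (S : Finset (Fin m → ZMod 2)) : Prop where
  low : ∀ A : Finset (Fin m), A.card ≤ 2 → ∑ x ∈ S, ∏ i ∈ A, x i = 0
  cubic : ∀ A : Finset (Fin m), A.card = 3 → ∑ x ∈ S, ∏ i ∈ A, x i = t A

namespace Realizes

variable {m : ℕ} {t : Finset (Fin m) → ZMod 2} {S : Finset (Fin m → ZMod 2)}

theorem card_eq_zero (h : Realizes t S) : (S.card : ZMod 2) = 0 := by
  simpa using h.low ∅ (by simp)

theorem even_card (h : Realizes t S) : Even S.card :=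
  (ZMod.natCast_eq_zero_iff_even).1 h.card_eq_zero

theorem sum_one (h : Realizes t S) (i : Fin m) : ∑ x ∈ S, x i = 0 := by
  simpa using h.low {i} (by simp)

theorem sum_two (h : Realizes t S) (i j : Fin m) : ∑ x ∈ S, x i * x j = 0 := by
  have sqr : ∀ a : ZMod 2, a * a = a := by decide
  by_cases hij : i = j
  · subst hij; simpa only [sqr] using h.sum_one i
  · simpa [Finset.prod_pair hij] using h.low {i, j} Finset.card_le_two

theorem sum_three (h : Realizes t S) (i j k : Fin m) :
    ∑ x ∈ S, x i * x j * x k =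
      if ({i, j, k} : Finset (Fin m)).card = 3 then t {i, j, k} else 0 := by
  have sqr : ∀ a : ZMod 2, a * a = a := by decide
  by_cases hij : i = j
  · subst hij
    rw [if_neg (by have := Finset.card_le_two (a := i) (b := k); simp; omega)]
    simpa only [sqr] using h.sum_two i k
  by_cases hjk : j = k
  · subst hjk
    rw [if_neg (by have := Finset.card_le_two (a := i) (b := j); simp; omega)]
    simpa only [mul_assoc, sqr] using h.sum_two i j
  by_cases hik : i = k
  · subst hik
    rw [if_neg (by
      have := Finset.card_le_two (a := i) (b := j)
      rw [Finset.pair_comm j i]; simp; omega)]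
    simpa only [mul_right_comm, sqr] using h.sum_two i j
  · have hc : ({i, j, k} : Finset (Fin m)).card = 3 :=
      Finset.card_eq_three.2 ⟨i, j, k, hij, hik, hjk, rfl⟩
    rw [if_pos hc, ← h.cubic _ hc]
    refine Finset.sum_congr rfl fun x _ => ?_
    rw [Finset.prod_insert (by simp [hij, hik]), Finset.prod_pair hjk, mul_assoc]

end Realizes

/-- The extremal cubic form on eight variables. -/
def t8 (A : Finset (Fin 8)) : ZMod 2 :=
  if A ∈ ({{0, 2, 5}, {0, 3, 6}, {0, 4, 7}, {1, 2, 7}, {1, 3, 5}, {1, 3, 7}, {1, 4, 6},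
    {2, 3, 4}} : Finset (Finset (Fin 8))) then 1 else 0

/-- The extremal cubic form on nine variables. -/
def t9 (A : Finset (Fin 9)) : ZMod 2 :=
  if A ∈ ({{0, 2, 5}, {0, 3, 6}, {0, 4, 7}, {1, 2, 7}, {1, 3, 5}, {1, 3, 7}, {1, 4, 6},
    {2, 3, 4}, {0, 1, 8}} : Finset (Finset (Fin 9))) then 1 else 0

set_option maxRecDepth 100000 in
theorem card_ge_of_moments {ι : Type*} (S : Finset ι) (X : ι → Fin 8 → ZMod 2)
    (h0 : (S.card : ZMod 2) = 0) (h1 : ∀ i, ∑ x ∈ S, X x i = 0)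
    (h2 : ∀ i j, ∑ x ∈ S, X x i * X x j = 0)
    (h3 : ∀ i j k, ¬ (({0, 1} : Finset (Fin 8)) ⊆ {i, j, k}) →
      ∑ x ∈ S, X x i * X x j * X x k = t8 {i, j, k}) : 26 ≤ S.card := by
  let K : Fin 3 → Fin 8 := ![2, 3, 4]
  let B : Fin 3 → Fin 8 := ![5, 6, 7]
  refine Moments.card_ge (p := fun x => X x 0) (q := fun x => X x 1)
    (k := fun x i => X x (K i)) (b := fun x j => X x (B j))
    ⟨h0, h1 _, h1 _, fun _ => h1 _, fun _ => h1 _, fun _ _ => h2 _ _, ?_, fun _ => h2 _ _,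
      fun _ => h2 _ _, fun _ _ => h2 _ _, fun i j => ?_, fun i j => ?_, fun i j l => ?_,
      fun _ _ => h2 _ _, fun i j l => ?_, fun _ => h2 _ _, fun _ => h2 _ _, fun i j => ?_,
      fun i j => ?_, ?_⟩
  · exact (h3 5 6 7 (by decide)).trans (by decide)
  · refine (h3 0 (B i) (B j) ?_).trans ?_ <;> revert i j <;> decide
  · refine (h3 1 (B i) (B j) ?_).trans ?_ <;> revert i j <;> decide
  · refine (h3 (K i) (B j) (B l) ?_).trans ?_ <;> revert i j l <;> decide
  · refine (h3 (K i) (K j) (B l) ?_).trans ?_ <;> revert i j l <;> decide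
  · refine (h3 0 (K i) (B j) ?_).trans ?_ <;> revert i j <;> decide
  · refine (h3 1 (K i) (B j) ?_).trans ?_ <;> revert i j <;> decide
  · exact (h3 2 3 4 (by decide)).trans (by decide)

set_option maxRecDepth 100000 in
theorem card_ge_of_realizes_t8 (S : Finset (Fin 8 → ZMod 2)) (h : Realizes t8 S) :
    26 ≤ S.card := by
  refine card_ge_of_moments S id h.card_eq_zero h.sum_one h.sum_two fun i j k _ => ?_
  have := h.sum_three i j k
  simp only [id]
  rw [this]
  split_ifs with hc
  · rfl
  · have key : ∀ A ∈ ({{0, 2, 5}, {0, 3, 6}, {0, 4, 7}, {1, 2, 7}, {1, 3, 5}, {1, 3, 7},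
        {1, 4, 6}, {2, 3, 4}} : Finset (Finset (Fin 8))), A.card = 3 := by decide
    rw [t8, if_neg fun hA => hc (key _ hA)]

set_option maxRecDepth 100000 in
theorem t9_eq_zero_of_mem : ∀ i j : Fin 8, ¬ (({0, 1} : Finset (Fin 8)) ⊆ {i, j}) →
    t9 {i.castSucc, j.castSucc, 8} = 0 := by decide

set_option maxRecDepth 100000 in
set_option synthInstance.maxSize 1000 in
theorem t9_castSucc : ∀ i j k : Fin 8, ¬ (({0, 1} : Finset (Fin 8)) ⊆ {i, j, k}) →
    (if ({i.castSucc, j.castSucc, k.castSucc} : Finset (Fin 9)).card = 3 then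
      t9 {i.castSucc, j.castSucc, k.castSucc} else 0) = t8 {i, j, k} := by decide

theorem card_ge_of_realizes_t9 (S : Finset (Fin 9 → ZMod 2)) (h : Realizes t9 S) :
    28 ≤ S.card := by
  have hz : ∑ x ∈ S, x 0 * x 1 * x 8 = 1 := (h.sum_three 0 1 8).trans (by decide)
  obtain ⟨x, hx, hx8⟩ : ∃ x ∈ S, x 8 = 1 := by
    by_contra hcon
    push Not at hcon
    rw [Finset.sum_eq_zero] at hz
    · exact zero_ne_one hz
    · intro x hx
      rcases zmod2_eq_zero_or_one (x 8) with h' | h'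
      · rw [h', mul_zero]
      · exact absurd h' (hcon x hx)
  obtain ⟨y, hy, hy8⟩ : ∃ y ∈ S, y 8 = 0 := by
    by_contra hcon
    push Not at hcon
    have : ∑ x ∈ S, x 0 * x 1 * x 8 = ∑ x ∈ S, x 0 * x 1 := by
      refine Finset.sum_congr rfl fun x hx => ?_
      rcases zmod2_eq_zero_or_one (x 8) with h' | h'
      · exact absurd h' (hcon x hx)
      · rw [h', mul_one]
    rw [this, h.sum_two] at hz
    exact zero_ne_one hz
  have hxy : y ≠ x := by
    rintro rfl
    exact zero_ne_one (hy8.symm.trans hx8)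
  have hyx : y ∈ S.erase x := Finset.mem_erase.2 ⟨hxy, hy⟩
  let v : Fin 8 → ZMod 2 := fun i => x i.castSucc + y i.castSucc
  let X : (Fin 9 → ZMod 2) → Fin 8 → ZMod 2 := fun w i => w i.castSucc + w 8 * v i
  have hX : X x = X y := by
    ext i
    simp only [X, v, hx8, hy8]
    linear_combination zmod2_add_self (x i.castSucc)
  have hsum : ∀ f : (Fin 8 → ZMod 2) → ZMod 2,
      ∑ w ∈ (S.erase x).erase y, f (X w) = ∑ w ∈ S, f (X w) := by
    intro f
    rw [← Finset.add_sum_erase S _ hx, ← Finset.add_sum_erase _ _ hyx, hX]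
    linear_combination (-1 : ZMod 2) * zmod2_add_self (f (X y))
  have hcard : ((S.erase x).erase y).card + 2 = S.card := by
    rw [← Finset.card_erase_add_one hx, ← Finset.card_erase_add_one hyx]
  suffices 26 ≤ ((S.erase x).erase y).card by omega
  have sqr : ∀ a : ZMod 2, a * a = a := by decide
  have hp : ∀ w, ∀ i j, X w i * X w j = w i.castSucc * w j.castSucc
      + v j * (w i.castSucc * w 8) + v i * (w j.castSucc * w 8) + v i * v j * w 8 := by
    intro w i j
    simp only [X]
    linear_combination v i * v j * sqr (w 8)
  refine card_ge_of_moments _ X ?_ (fun i => ?_) (fun i j => ?_) fun i j k hijk => ?_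
  · have := h.card_eq_zero
    rw [← hcard] at this
    push_cast at this
    rwa [show (2 : ZMod 2) = 0 from rfl, add_zero] at this
  · rw [hsum fun c => c i]
    simp only [X, Finset.sum_add_distrib, ← Finset.sum_mul, h.sum_one]
    simp
  · rw [hsum fun c => c i * c j]
    simp only [hp, Finset.sum_add_distrib, ← Finset.mul_sum, h.sum_one, h.sum_two]
    simp
  · rw [hsum fun c => c i * c j * c k]
    have ht : ∀ w, X w i * X w j * X w k = w i.castSucc * w j.castSucc * w k.castSucc
        + v k * (w i.castSucc * w j.castSucc * w 8) + v j * (w i.castSucc * w k.castSucc * w 8)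
        + v i * (w j.castSucc * w k.castSucc * w 8) + v i * v j * (w k.castSucc * w 8)
        + v i * v k * (w j.castSucc * w 8) + v j * v k * (w i.castSucc * w 8)
        + v i * v j * v k * w 8 := by
      intro w
      rw [hp]
      simp only [X]
      linear_combination (v k * v j * w i.castSucc + v k * v i * w j.castSucc
        + v i * v j * v k) * sqr (w 8)
    have hz : ∀ i j : Fin 8, ¬ (({0, 1} : Finset (Fin 8)) ⊆ {i, j}) →
        ∑ w ∈ S, w i.castSucc * w j.castSucc * w 8 = 0 := by
      intro i j hij
      rw [h.sum_three, t9_eq_zero_of_mem i j hij, ite_self]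
    have mono : ∀ a b : Fin 8, ({a, b} : Finset (Fin 8)) ⊆ {i, j, k} →
        ¬ (({0, 1} : Finset (Fin 8)) ⊆ {a, b}) := fun a b hab h' => hijk (h'.trans hab)
    simp only [ht, Finset.sum_add_distrib, ← Finset.mul_sum, h.sum_one, h.sum_two]
    rw [hz i j (mono i j (by grind)), hz i k (mono i k (by grind)), hz j k (mono j k (by grind)),
      h.sum_three, t9_castSucc i j k hijk]
    simp

section Tuples

variable {n : ℕ}

/-- The independent self-orthogonal tuples of vectors with vanishing first coordinate. -/
structure IsGood {k : ℕ} (r : Fin k → Fin (n + 1) → ZMod 2) : Prop where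
  base : ∀ i, r i 0 = 0
  sum : ∀ i, ∑ j, r i j = 0
  orth : ∀ i i', ∑ j, r i j * r i' j = 0
  indep : ∀ c : Fin k → ZMod 2, (∀ j, ∑ i, c i * r i j = 0) → c = 0

theorem IsGood.castSucc {k : ℕ} {r : Fin (k + 1) → Fin (n + 1) → ZMod 2} (h : IsGood r) :
    IsGood (fun i => r (Fin.castSucc i)) := by
  refine ⟨fun i => h.base _, fun i => h.sum _, fun i i' => h.orth _ _, fun c hc => ?_⟩
  have := h.indep (Fin.snoc c 0) (by
    intro j
    rw [Fin.sum_univ_castSucc]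
    simpa using hc j)
  ext i
  simpa using congrFun this i.castSucc

/-- The vectors orthogonal to a good tuple, to the all-one vector and to the first unit vector
form a space of the expected size. -/
theorem card_orthogonal {k : ℕ} {r : Fin k → Fin (n + 1) → ZMod 2} (h : IsGood r)
    (hn : ((n + 1 : ℕ) : ZMod 2) = 0) :
    Nat.card {v : Fin (n + 1) → ZMod 2 //
      v 0 = 0 ∧ ∑ j, v j = 0 ∧ ∀ i, ∑ j, r i j * v j = 0} * 2 ^ (k + 2) ≤ 2 ^ (n + 1) := by
  let W : Matrix (Option (Option (Fin k))) (Fin (n + 1)) (ZMod 2) := fun o =>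
    match o with
    | none => Pi.single 0 1
    | some none => fun _ => 1
    | some (some i) => r i
  have hW : LinearIndependent (ZMod 2) W.row := by
    rw [Fintype.linearIndependent_iff]
    intro c hc
    have hj : ∀ j, c none * (Pi.single 0 1 : Fin (n + 1) → ZMod 2) j
        + (c (some none) + ∑ i, c (some (some i)) * r i j) = 0 := by
      intro j
      have := congrFun hc j
      simpa [Fintype.sum_option, W, Matrix.row] using this
    have h0 := hj 0
    simp only [Pi.single_eq_same, h.base, mul_zero, Finset.sum_const_zero, mul_one, add_zero] at h0
    have hs : ∑ j, (c none * (Pi.single 0 1 : Fin (n + 1) → ZMod 2) j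
        + (c (some none) + ∑ i, c (some (some i)) * r i j)) = 0 :=
      Finset.sum_eq_zero fun j _ => hj j
    rw [Finset.sum_add_distrib, Finset.sum_add_distrib, ← Finset.mul_sum, Finset.sum_comm] at hs
    simp only [← Finset.mul_sum, h.sum] at hs
    have hn' : ((n : ZMod 2) + 1) = 0 := by exact_mod_cast hn
    simp [hn'] at hs
    rw [hs, zero_add] at h0
    have := h.indep (fun i => c (some (some i))) (by
      intro j
      have := hj j
      rwa [hs, h0, zero_mul, zero_add, zero_add] at this)
    rintro (_ | _ | i)
    · exact hs
    · exact h0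
    · exact congrFun this i
  have hrank := hW.rank_matrix
  have hker := LinearMap.finrank_range_add_finrank_ker W.mulVecLin
  rw [Matrix.rank] at hrank
  rw [hrank] at hker
  simp only [Fintype.card_option, Fintype.card_fin, Module.finrank_fintype_fun_eq_card] at hker
  have hcard : Nat.card (LinearMap.ker W.mulVecLin) =
      2 ^ Module.finrank (ZMod 2) (LinearMap.ker W.mulVecLin) := by
    rw [Module.natCard_eq_pow_finrank (K := ZMod 2), Nat.card_zmod]
  have hle : Nat.card {v : Fin (n + 1) → ZMod 2 //
      v 0 = 0 ∧ ∑ j, v j = 0 ∧ ∀ i, ∑ j, r i j * v j = 0}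
      ≤ Nat.card (LinearMap.ker W.mulVecLin) := by
    refine Nat.card_le_card_of_injective (fun v => ⟨v.1, ?_⟩) ?_
    · obtain ⟨v, h0, h1, h2⟩ := v
      rw [LinearMap.mem_ker, Matrix.mulVecLin_apply]
      ext o
      rcases o with _ | _ | i
      · simp [Matrix.mulVec, dotProduct, W, Pi.single_apply, h0]
      · simp [Matrix.mulVec, dotProduct, W, h1]
      · exact h2 i
    · intro v v' hv
      exact Subtype.ext (congrArg (fun z : LinearMap.ker W.mulVecLin => z.1) hv)
  calc _ ≤ _ := Nat.mul_le_mul_right _ hle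
    _ = 2 ^ (k + 1 + 1 + Module.finrank (ZMod 2) (LinearMap.ker W.mulVecLin)) := by
      rw [hcard, ← pow_add, add_comm]
    _ = 2 ^ (n + 1) := congrArg (2 ^ ·) hker

open Classical in
theorem card_good_succ (k : ℕ) (hn : ((n + 1 : ℕ) : ZMod 2) = 0) :
    (Finset.univ.filter fun r : Fin (k + 1) → Fin (n + 1) → ZMod 2 => IsGood r).card
        * 2 ^ (k + 2) ≤
      (Finset.univ.filter fun r : Fin k → Fin (n + 1) → ZMod 2 => IsGood r).card
        * 2 ^ (n + 1) := by
  rw [Finset.card_eq_sum_card_fiberwise (f := fun r i => r (Fin.castSucc i))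
    (t := Finset.univ.filter fun r : Fin k → Fin (n + 1) → ZMod 2 => IsGood r)
    (by
      intro r hr
      simp only [Finset.coe_filter, Finset.mem_univ, true_and, Set.mem_ofPred_eq] at hr ⊢
      exact hr.castSucc), Finset.sum_mul, ← smul_eq_mul (a := Finset.card _)]
  refine Finset.sum_le_card_nsmul _ _ _ fun r hr => ?_
  rw [Finset.mem_filter] at hr
  refine le_trans (Nat.mul_le_mul_right _ ?_) (card_orthogonal hr.2 hn)
  rw [← Nat.card_eq_finsetCard]
  refine Nat.card_le_card_of_injective (fun r' => ⟨r'.1 (Fin.last k), ?_⟩) ?_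
  · obtain ⟨r', h'⟩ := r'
    rw [Finset.mem_filter, Finset.mem_filter] at h'
    obtain ⟨⟨-, hg⟩, hi⟩ := h'
    refine ⟨hg.base _, hg.sum _, fun i => ?_⟩
    rw [← congrFun hi i]
    exact hg.orth _ _
  · rintro ⟨a, ha⟩ ⟨b, hb⟩ hab
    rw [Finset.mem_filter] at ha hb
    have hab' : a (Fin.last k) = b (Fin.last k) := congrArg Subtype.val hab
    refine Subtype.ext (funext fun i => ?_)
    refine Fin.lastCases hab' (fun i => ?_) i
    exact (congrFun ha.2 i).trans (congrFun hb.2 i).symm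

open Classical in
theorem card_good_le (m : ℕ) (hn : ((n + 1 : ℕ) : ZMod 2) = 0) :
    (Finset.univ.filter fun r : Fin m → Fin (n + 1) → ZMod 2 => IsGood r).card
      * 2 ^ (∑ k ∈ Finset.range m, (k + 2)) ≤ 2 ^ (m * (n + 1)) := by
  induction m with
  | zero =>
    rw [Finset.sum_range_zero, pow_zero, mul_one, zero_mul, pow_zero]
    exact (Finset.card_le_univ _).trans (by simp)
  | succ k ih =>
    rw [Finset.sum_range_succ, pow_add, mul_comm (2 ^ _) (2 ^ (k + 2)), ← mul_assoc]
    calc _ ≤ _ := Nat.mul_le_mul_right _ (card_good_succ k hn)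
      _ = _ * 2 ^ (∑ k ∈ Finset.range k, (k + 2)) * 2 ^ (n + 1) := by
        rw [mul_right_comm]
      _ ≤ _ := Nat.mul_le_mul_right _ ih
      _ = _ := by rw [← pow_add]; congr 1; ring

end Tuples

/-- Extension by zero of a function on the sets of size three. -/
def extendCubic {m : ℕ} (t : {A : Finset (Fin m) // A.card = 3} → ZMod 2) (A : Finset (Fin m)) :
    ZMod 2 :=
  if h : A.card = 3 then t ⟨A, h⟩ else 0

theorem Realizes.sum_extend {m : ℕ} {t : {A : Finset (Fin m) // A.card = 3} → ZMod 2}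
    {S : Finset (Fin m → ZMod 2)} (h : Realizes (extendCubic t) S) (i j k : Fin m) :
    ∑ x ∈ S, x i * x j * x k = extendCubic t {i, j, k} := by
  rw [h.sum_three]
  split_ifs with hc
  · rfl
  · rw [extendCubic, dif_neg hc]

theorem extendCubic_injective {m : ℕ} {t t' : {A : Finset (Fin m) // A.card = 3} → ZMod 2}
    (h : ∀ i j k, extendCubic t {i, j, k} = extendCubic t' {i, j, k}) : t = t' := by
  ext ⟨A, hA⟩
  obtain ⟨i, j, k, -, -, -, rfl⟩ := Finset.card_eq_three.1 hA
  have := h i j k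
  rwa [extendCubic, extendCubic, dif_pos hA, dif_pos hA] at this

theorem Realizes.sum_translate {m : ℕ} {t : {A : Finset (Fin m) // A.card = 3} → ZMod 2}
    {S : Finset (Fin m → ZMod 2)} (h : Realizes (extendCubic t) S) (a : Fin m → ZMod 2)
    (i j k : Fin m) :
    ∑ x ∈ S, (x i + a i) * (x j + a j) * (x k + a k) = extendCubic t {i, j, k} := by
  have : ∀ x : Fin m → ZMod 2, (x i + a i) * (x j + a j) * (x k + a k) =
      x i * x j * x k + a k * (x i * x j) + a j * (x i * x k) + a i * (x j * x k)
      + a i * a j * x k + a i * a k * x j + a j * a k * x i + a i * a j * a k := by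
    intro x; ring
  simp only [this, Finset.sum_add_distrib, ← Finset.mul_sum, h.sum_one, h.sum_two, h.sum_extend,
    Finset.sum_const, nsmul_eq_mul, h.card_eq_zero]
  ring

section Count

variable {m : ℕ}

/-- `S` lies in an affine hyperplane transverse to the `p`-th coordinate. -/
def IsDegenerate (S : Finset (Fin m → ZMod 2)) (p : Fin m) : Prop :=
  ∃ (l : Fin m → ZMod 2) (c : ZMod 2), l p = 1 ∧ ∀ x ∈ S, ∑ i, l i * x i = c

/-- `S` is invariant under a nonzero translation. -/
def IsPeriodic (S : Finset (Fin m → ZMod 2)) : Prop :=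
  ∃ d : Fin m → ZMod 2, d ≠ 0 ∧ ∀ x ∈ S, x + d ∈ S

variable (F : ({A : Finset (Fin m) // A.card = 3} → ZMod 2) → Finset (Fin m → ZMod 2))

theorem isGood_of_enum {t : {A : Finset (Fin m) // A.card = 3} → ZMod 2}
    {S : Finset (Fin m → ZMod 2)} (h : Realizes (extendCubic t) S)
    (hd : ∀ p, ¬ IsDegenerate S p) {n : ℕ} (e : Fin (n + 1) ≃ S) :
    IsGood (fun i j => (e j).1 i + (e 0).1 i) := by
  have hsum : ∀ f : (Fin m → ZMod 2) → ZMod 2, ∑ j, f (e j).1 = ∑ x ∈ S, f x := by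
    intro f
    rw [← Finset.sum_coe_sort S f]
    exact Equiv.sum_comp e fun x => f x.1
  refine ⟨fun i => zmod2_add_self _, fun i => ?_, fun i i' => ?_, fun c hc => ?_⟩
  · rw [hsum fun x => x i + (e 0).1 i, Finset.sum_add_distrib, h.sum_one]
    simp [h.card_eq_zero]
  · rw [hsum fun x => (x i + (e 0).1 i) * (x i' + (e 0).1 i')]
    have : ∀ (x a : Fin m → ZMod 2), (x i + a i) * (x i' + a i') =
        x i * x i' + a i' * x i + a i * x i' + a i * a i' := by intro x a; ring
    simp only [this, Finset.sum_add_distrib, ← Finset.mul_sum, h.sum_one, h.sum_two,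
      Finset.sum_const, nsmul_eq_mul, h.card_eq_zero]
    ring
  · by_contra hne
    obtain ⟨p, hp⟩ := Function.ne_iff.1 hne
    refine hd p ⟨c, ∑ i, c i * (e 0).1 i, (zmod2_eq_zero_or_one _).resolve_left hp, ?_⟩
    intro x hx
    have := hc (e.symm ⟨x, hx⟩)
    simp only [Equiv.apply_symm_apply, mul_add, Finset.sum_add_distrib] at this
    exact CharTwo.add_eq_zero.1 this

open Classical in
theorem factorial_mul_card_le (hF : ∀ t, Realizes (extendCubic t) (F t)) (n : ℕ)
    (hn : ((n + 1 : ℕ) : ZMod 2) = 0) :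
    (n + 1).factorial * (Finset.univ.filter fun t => (F t).card = n + 1 ∧
        (∀ p, ¬ IsDegenerate (F t) p) ∧ ¬ IsPeriodic (F t)).card
      * 2 ^ (∑ k ∈ Finset.range m, (k + 2)) ≤ 2 ^ (m * (n + 1)) := by
  refine le_trans (Nat.mul_le_mul_right _ ?_) (card_good_le m hn)
  set N := Finset.univ.filter fun t => (F t).card = n + 1 ∧
        (∀ p, ¬ IsDegenerate (F t) p) ∧ ¬ IsPeriodic (F t) with hN
  have hN' : ∀ t : N, (F t.1).card = n + 1 ∧ (∀ p, ¬ IsDegenerate (F t) p) ∧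
      ¬ IsPeriodic (F t) := fun t => (Finset.mem_filter.1 t.2).2
  let e : ∀ t : N, Fin (n + 1) ≃ F t.1 := fun t => ((F t.1).equivFinOfCardEq (hN' t).1).symm
  have hcard : (n + 1).factorial * N.card = Nat.card (Equiv.Perm (Fin (n + 1)) × N) := by
    rw [Nat.card_prod, Nat.card_eq_fintype_card, Fintype.card_perm, Fintype.card_fin,
      Nat.card_eq_finsetCard]
  rw [hcard, ← Nat.card_eq_finsetCard]
  refine Nat.card_le_card_of_injective
    (fun a => ⟨fun i j => (e a.2 (a.1 j)).1 i + (e a.2 (a.1 0)).1 i, ?_⟩) ?_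
  · rw [Finset.mem_filter]
    exact ⟨Finset.mem_univ _, isGood_of_enum (hF _) (hN' a.2).2.1 (a.1.trans (e a.2))⟩
  · rintro ⟨σ, t⟩ ⟨τ, t'⟩ hab
    have hab : ∀ i j, (e t (σ j)).1 i + (e t (σ 0)).1 i
        = (e t' (τ j)).1 i + (e t' (τ 0)).1 i := fun i j =>
      congrFun (congrFun (congrArg Subtype.val hab) i) j
    have hmom : ∀ (t : N) (σ : Equiv.Perm (Fin (n + 1))) (i j k : Fin m),
        ∑ l, ((e t (σ l)).1 i + (e t (σ 0)).1 i) * ((e t (σ l)).1 j + (e t (σ 0)).1 j)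
          * ((e t (σ l)).1 k + (e t (σ 0)).1 k) = extendCubic t.1 {i, j, k} := by
      intro t σ i j k
      rw [← (hF t.1).sum_translate (e t (σ 0)).1, ← Finset.sum_coe_sort (F t.1)]
      exact Equiv.sum_comp (σ.trans (e t)) fun x =>
        (x.1 i + (e t (σ 0)).1 i) * (x.1 j + (e t (σ 0)).1 j) * (x.1 k + (e t (σ 0)).1 k)
    obtain rfl : t = t' := by
      refine Subtype.ext (extendCubic_injective fun i j k => ?_)
      rw [← hmom t σ, ← hmom t' τ]
      simp only [hab]
    have hd : (e t (σ 0)).1 + (e t (τ 0)).1 = 0 := by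
      by_contra hne
      refine (hN' t).2.2 ⟨_, hne, fun x hx => ?_⟩
      have : x + ((e t (σ 0)).1 + (e t (τ 0)).1) = (e t (τ (σ.symm ((e t).symm ⟨x, hx⟩)))).1 := by
        ext i
        have := hab i (σ.symm ((e t).symm ⟨x, hx⟩))
        simp only [Equiv.apply_symm_apply] at this
        simp only [Pi.add_apply]
        linear_combination this + zmod2_add_self ((e t (τ 0)).1 i)
      rw [this]
      exact (e t _).2
    have hστ : σ = τ := by
      ext j
      congr 1
      refine (e t).injective (Subtype.ext (funext fun i => ?_))
      have h1 := hab i j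
      have h2 : (e t (σ 0)).1 i + (e t (τ 0)).1 i = 0 := congrFun hd i
      rw [CharTwo.add_eq_zero.1 h2] at h1
      exact add_right_cancel h1
    rw [hστ]

end Count

section Exceptional

variable {m : ℕ}
  (F : ({A : Finset (Fin m) // A.card = 3} → ZMod 2) → Finset (Fin m → ZMod 2))

theorem sum_mul_of_linear {t : {A : Finset (Fin m) // A.card = 3} → ZMod 2}
    {S : Finset (Fin m → ZMod 2)} (h : Realizes (extendCubic t) S) {p : Fin m}
    {l : Fin m → ZMod 2} {c : ZMod 2} (hp : l p = 1) (hl : ∀ x ∈ S, ∑ i, l i * x i = c)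
    (i j : Fin m) : extendCubic t {p, i, j} =
      ∑ r ∈ Finset.univ.erase p, l r * extendCubic t {r, i, j} := by
  have h0 : ∑ r, l r * extendCubic t {r, i, j} = 0 := by
    simp only [← h.sum_extend, Finset.mul_sum]
    rw [Finset.sum_comm]
    have : ∀ x ∈ S, ∑ r, l r * (x r * x i * x j) = c * (x i * x j) := by
      intro x hx
      rw [← hl x hx, Finset.sum_mul]
      exact Finset.sum_congr rfl fun r _ => by ring
    rw [Finset.sum_congr rfl this, ← Finset.mul_sum, h.sum_two, mul_zero]
  rw [← Finset.add_sum_erase _ _ (Finset.mem_univ p), hp, one_mul] at h0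
  exact CharTwo.add_eq_zero.1 h0

open Classical in
theorem card_degenerate_le (hF : ∀ t, Realizes (extendCubic t) (F t)) (p : Fin m) :
    (Finset.univ.filter fun t => IsDegenerate (F t) p).card ≤
      2 ^ m * 2 ^ ((m - 1).choose 3) := by
  have hd : ∀ t : (Finset.univ.filter fun t => IsDegenerate (F t) p),
      IsDegenerate (F t.1) p := fun t => (Finset.mem_filter.1 t.2).2
  choose l c hp hl using hd
  have hcard : 2 ^ m * 2 ^ ((m - 1).choose 3) = Nat.card ((Fin m → ZMod 2) ×
      ((Finset.univ.erase p).powersetCard 3 → ZMod 2)) := by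
    rw [Nat.card_prod, Nat.card_fun, Nat.card_fun, Nat.card_eq_finsetCard,
      Finset.card_powersetCard, Finset.card_erase_of_mem (Finset.mem_univ p)]
    simp
  rw [hcard, ← Nat.card_eq_finsetCard]
  refine Nat.card_le_card_of_injective
    (fun t => (l t, fun A => extendCubic t.1 A.1)) fun t t' htt => ?_
  obtain ⟨h1, h2⟩ := Prod.mk.inj htt
  have hA : ∀ A : Finset (Fin m), p ∉ A → extendCubic t.1 A = extendCubic t'.1 A := by
    intro A hpA
    by_cases hc : A.card = 3
    · refine congrFun h2 ⟨A, ?_⟩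
      rw [Finset.mem_powersetCard, Finset.subset_erase]
      exact ⟨⟨Finset.subset_univ _, hpA⟩, hc⟩
    · rw [extendCubic, extendCubic, dif_neg hc, dif_neg hc]
  have hfirst : ∀ i j, i ≠ p → j ≠ p →
      extendCubic t.1 {p, i, j} = extendCubic t'.1 {p, i, j} := by
    intro i j hi hj
    rw [sum_mul_of_linear (hF _) (hp t) (hl t), sum_mul_of_linear (hF _) (hp t') (hl t'), h1]
    refine Finset.sum_congr rfl fun r hr => ?_
    rw [hA]
    simp [hi.symm, hj.symm, (Finset.ne_of_mem_erase hr).symm]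
  refine Subtype.ext (funext fun A => ?_)
  have key : extendCubic t.1 A.1 = extendCubic t'.1 A.1 := by
    by_cases hpA : p ∈ A.1
    · have h2 : (A.1.erase p).card = 2 := by rw [Finset.card_erase_of_mem hpA, A.2]
      obtain ⟨i, j, -, hij⟩ := Finset.card_eq_two.1 h2
      have hi : i ∈ A.1.erase p := by rw [hij]; simp
      have hj : j ∈ A.1.erase p := by rw [hij]; simp
      rw [← Finset.insert_erase hpA, hij]
      exact hfirst i j (Finset.ne_of_mem_erase hi) (Finset.ne_of_mem_erase hj)
    · exact hA _ hpA
  rwa [extendCubic, extendCubic, dif_pos A.2, dif_pos A.2] at key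

theorem sum_of_translate {S : Finset (Fin m → ZMod 2)} {d : Fin m → ZMod 2} {p : Fin m}
    (hp : d p = 1) (hd : ∀ x ∈ S, x + d ∈ S) (f : (Fin m → ZMod 2) → ZMod 2) :
    ∑ x ∈ S, f x = ∑ x ∈ S with x p = 0, (f x + f (x + d)) := by
  have dd : ∀ x : Fin m → ZMod 2, x + d + d = x := by
    intro x; ext i
    simp only [Pi.add_apply]
    linear_combination zmod2_add_self (d i)
  rw [Finset.sum_add_distrib, ← Finset.sum_filter_add_sum_filter_not S (fun x => x p = 0)]
  congr 1
  refine Finset.sum_nbij' (fun x => x + d) (fun x => x + d) ?_ ?_ ?_ ?_ ?_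
  · intro x hx
    rw [Finset.mem_filter] at hx ⊢
    refine ⟨hd x hx.1, ?_⟩
    rw [Pi.add_apply, hp, (zmod2_eq_zero_or_one _).resolve_left hx.2]
    exact zmod2_add_self 1
  · intro x hx
    rw [Finset.mem_filter] at hx ⊢
    refine ⟨hd x hx.1, ?_⟩
    rw [Pi.add_apply, hp, hx.2, zero_add]
    exact one_ne_zero
  · intro x _; exact dd x
  · intro x _; exact dd x
  · intro x _; rw [dd]

theorem extendCubic_eq_of_periodic {t : {A : Finset (Fin m) // A.card = 3} → ZMod 2}
    {S : Finset (Fin m → ZMod 2)} (h : Realizes (extendCubic t) S) {d : Fin m → ZMod 2}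
    {p : Fin m} (hp : d p = 1) (hd : ∀ x ∈ S, x + d ∈ S) (M : Fin m → Fin m → ZMod 2)
    (hM : M = fun i j => ∑ x ∈ S with x p = 0, x i * x j) (i j k : Fin m) :
    extendCubic t {i, j, k} = d i * M j k + d j * M i k + d k * M i j
      + d i * d j * M k k + d i * d k * M j j + d j * d k * M i i
      + d i * d j * d k * ((S.filter fun x => x p = 0).card : ZMod 2) := by
  have sqr : ∀ a : ZMod 2, a * a = a := by decide
  rw [← h.sum_extend, sum_of_translate hp hd, hM]
  have : ∀ x : Fin m → ZMod 2, x i * x j * x k + (x + d) i * (x + d) j * (x + d) k =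
      d i * (x j * x k) + d j * (x i * x k) + d k * (x i * x j) + d i * d j * (x k * x k)
      + d i * d k * (x j * x j) + d j * d k * (x i * x i) + d i * d j * d k := by
    intro x
    simp only [Pi.add_apply, sqr]
    linear_combination zmod2_add_self (x i * x j * x k)
  simp only [this, Finset.sum_add_distrib, ← Finset.mul_sum, Finset.sum_const, nsmul_eq_mul]
  ring

open Classical in
theorem card_periodic_le (hF : ∀ t, Realizes (extendCubic t) (F t)) :
    (Finset.univ.filter fun t => IsPeriodic (F t)).card ≤ 2 ^ (m * m + m + 1) := by
  have hd : ∀ t : (Finset.univ.filter fun t => IsPeriodic (F t)),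
      ∃ d : Fin m → ZMod 2, ∃ p, d p = 1 ∧ ∀ x ∈ F t.1, x + d ∈ F t.1 := by
    intro t
    obtain ⟨d, hne, hd⟩ := (Finset.mem_filter.1 t.2).2
    obtain ⟨p, hp⟩ := Function.ne_iff.1 hne
    exact ⟨d, p, (zmod2_eq_zero_or_one _).resolve_left hp, hd⟩
  choose d p hp hd using hd
  have hcard : 2 ^ (m * m + m + 1) = Nat.card ((Fin m → ZMod 2) ×
      (Fin m → Fin m → ZMod 2) × ZMod 2) := by
    simp
    ring
  rw [hcard, ← Nat.card_eq_finsetCard]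
  refine Nat.card_le_card_of_injective
    (fun t => (d t, (fun i j => ∑ x ∈ F t.1 with x (p t) = 0, x i * x j),
      (((F t.1).filter fun x => x (p t) = 0).card : ZMod 2))) fun t t' htt => ?_
  simp only [Prod.mk.injEq] at htt
  obtain ⟨h1, h2, h3⟩ := htt
  refine Subtype.ext (extendCubic_injective fun i j k => ?_)
  rw [extendCubic_eq_of_periodic (hF _) (hp t) (hd t) _ rfl,
    extendCubic_eq_of_periodic (hF _) (hp t') (hd t') _ h2, h1, h3]

end Exceptional

theorem le_choose_two {m : ℕ} (hm : 10 ≤ m) : 4 * m + 5 ≤ m.choose 2 := by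
  induction m, hm using Nat.le_induction with
  | base => decide
  | succ m hm ih =>
    have h : (m + 1).choose 2 = m + m.choose 2 := by
      rw [Nat.choose_succ_succ' m 1, Nat.choose_one_right]
    omega

theorem le_choose_three {m : ℕ} (hm : 10 ≤ m) : m * m + m + 4 ≤ m.choose 3 := by
  induction m, hm using Nat.le_induction with
  | base => decide
  | succ m hm ih =>
    have h : (m + 1).choose 3 = m.choose 2 + m.choose 3 := Nat.choose_succ_succ' m 2
    have := le_choose_two hm
    nlinarith

theorem two_pow_le_factorial_mul {m : ℕ} (hm : 10 ≤ m) :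
    2 ^ (m * (2 * m + 8) + 2) ≤
      (2 * m + 8).factorial * 2 ^ (∑ k ∈ Finset.range m, (k + 2)) * 2 ^ m.choose 3 := by
  induction m, hm using Nat.le_induction with
  | base =>
    have h1 : ∑ k ∈ Finset.range 10, (k + 2) = 65 := by decide
    have h2 : Nat.choose 10 3 = 120 := by decide
    have h3 : 2 ^ 97 ≤ (2 * 10 + 8).factorial := by norm_num [Nat.factorial]
    have h4 : 10 * (2 * 10 + 8) + 2 = 97 + 65 + 120 := by norm_num
    rw [h1, h2, h4]
    generalize (2 * 10 + 8).factorial = x at h3 ⊢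
    rw [pow_add, pow_add]
    gcongr
  | succ m hm ih =>
    have e1 : (m + 1) * (2 * (m + 1) + 8) + 2 = (m * (2 * m + 8) + 2) + (4 * m + 10) := by ring
    have e2 : (2 * (m + 1) + 8).factorial =
        (2 * m + 10) * ((2 * m + 9) * (2 * m + 8).factorial) := by
      rw [show 2 * (m + 1) + 8 = (2 * m + 9) + 1 by ring, Nat.factorial_succ,
        show 2 * m + 9 = (2 * m + 8) + 1 by ring, Nat.factorial_succ]
    have e3 : (m + 1).choose 3 = m.choose 2 + m.choose 3 := Nat.choose_succ_succ' m 2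
    rw [e1, e2, e3, Finset.sum_range_succ, pow_add 2 (m * (2 * m + 8) + 2), pow_add 2 (m.choose 2),
      pow_add 2 (∑ k ∈ Finset.range m, (k + 2))]
    have h1 : 2 ^ (4 * m + 10) ≤ 2 ^ 8 * (2 ^ (m + 2) * 2 ^ m.choose 2) := by
      rw [← pow_add, ← pow_add]
      have := le_choose_two hm
      exact Nat.pow_le_pow_right (by norm_num) (by omega)
    have h2 : 2 ^ 8 ≤ (2 * m + 10) * (2 * m + 9) := by nlinarith
    calc _ ≤ ((2 * m + 8).factorial * 2 ^ (∑ k ∈ Finset.range m, (k + 2)) * 2 ^ m.choose 3) *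
          (((2 * m + 10) * (2 * m + 9)) * (2 ^ (m + 2) * 2 ^ m.choose 2)) :=
          Nat.mul_le_mul ih (h1.trans (Nat.mul_le_mul_right _ h2))
      _ = _ := by
        generalize 2 ^ (∑ k ∈ Finset.range m, (k + 2)) = u
        generalize (2 * m + 8).factorial = v
        generalize 2 ^ m.choose 2 = w
        generalize 2 ^ m.choose 3 = z
        ring

theorem factorial_mul_two_pow_le {m : ℕ} (hm : 10 ≤ m) (j : ℕ) : ∀ s, s + j = 2 * m + 8 →
    (2 * m + 8).factorial * 2 ^ j * 2 ^ (m * s) ≤ s.factorial * 2 ^ (m * (2 * m + 8)) := by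
  have h2 : 2 * (2 * m + 8) ≤ 2 ^ m := by
    induction m, hm using Nat.le_induction with
    | base => norm_num
    | succ m hm ih => rw [pow_succ]; omega
  induction j with
  | zero => rintro s rfl; simp
  | succ j ih =>
    intro s hs
    have h := ih (s + 1) (by omega)
    rw [Nat.factorial_succ s] at h
    have hs' : 2 * (s + 1) ≤ 2 ^ m := by omega
    have h3 : (s + 1) * ((2 * m + 8).factorial * 2 ^ (j + 1) * 2 ^ (m * s)) ≤
        (s + 1) * (s.factorial * 2 ^ (m * (2 * m + 8))) := by
      calc _ = (2 * m + 8).factorial * 2 ^ j * 2 ^ (m * s) * (2 * (s + 1)) := by ring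
        _ ≤ (2 * m + 8).factorial * 2 ^ j * 2 ^ (m * s) * 2 ^ m := Nat.mul_le_mul_left _ hs'
        _ = (2 * m + 8).factorial * 2 ^ j * 2 ^ (m * (s + 1)) := by ring
        _ ≤ _ := h
        _ = _ := by ring
    exact Nat.le_of_mul_le_mul_left h3 (Nat.succ_pos s)

open Classical in
theorem two_pow_mul_card_le {m : ℕ} (hm : 10 ≤ m)
    (F : ({A : Finset (Fin m) // A.card = 3} → ZMod 2) → Finset (Fin m → ZMod 2))
    (hF : ∀ t, Realizes (extendCubic t) (F t)) (s : ℕ) (hs : s ≤ 2 * m + 8) :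
    2 ^ (2 * m + 10) * (Finset.univ.filter fun t => (F t).card = s ∧
      (∀ p, ¬ IsDegenerate (F t) p) ∧ ¬ IsPeriodic (F t)).card ≤ 2 ^ s * 2 ^ m.choose 3 := by
  set N := Finset.univ.filter fun t => (F t).card = s ∧
      (∀ p, ¬ IsDegenerate (F t) p) ∧ ¬ IsPeriodic (F t) with hN
  rcases N.eq_empty_or_nonempty with h0 | ⟨t, ht⟩
  · rw [h0]; simp
  rw [hN, Finset.mem_filter] at ht
  obtain ⟨-, hts, htd, -⟩ := ht
  have hs0 : s ≠ 0 := by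
    rintro rfl
    refine htd ⟨0, by omega⟩ ⟨fun _ => 1, 0, rfl, fun x hx => ?_⟩
    rw [Finset.card_eq_zero.1 hts] at hx
    simp at hx
  obtain ⟨n, rfl⟩ : ∃ n, s = n + 1 := Nat.exists_eq_succ_of_ne_zero hs0
  have hn : ((n + 1 : ℕ) : ZMod 2) = 0 := by
    have := (hF t).card_eq_zero
    rwa [hts] at this
  obtain ⟨j, hj⟩ := Nat.exists_eq_add_of_le hs
  have h1 := factorial_mul_card_le F hF n hn
  have h2 := factorial_mul_two_pow_le hm j (n + 1) hj.symm
  have h3 := two_pow_le_factorial_mul hm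
  have pos : 0 < (2 * m + 8).factorial * (n + 1).factorial *
      2 ^ (∑ k ∈ Finset.range m, (k + 2)) * 2 ^ j := by positivity
  refine Nat.le_of_mul_le_mul_left ?_ pos
  set E := ∑ k ∈ Finset.range m, (k + 2)
  set a := (n + 1).factorial
  set b := (2 * m + 8).factorial
  have e : (2 : ℕ) ^ (2 * m + 10) = 2 ^ (n + 1) * 2 ^ j * 4 := by
    rw [show 2 * m + 10 = (n + 1) + j + 2 by omega, pow_add, pow_add]; norm_num
  calc b * a * 2 ^ E * 2 ^ j * (2 ^ (2 * m + 10) * N.card)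
      = (a * N.card * 2 ^ E) * (b * 2 ^ j * 2 ^ (2 * m + 10)) := by ring
    _ ≤ 2 ^ (m * (n + 1)) * (b * 2 ^ j * 2 ^ (2 * m + 10)) := Nat.mul_le_mul_right _ h1
    _ = (b * 2 ^ j * 2 ^ (m * (n + 1))) * 2 ^ (2 * m + 10) := by ring
    _ ≤ (a * 2 ^ (m * (2 * m + 8))) * 2 ^ (2 * m + 10) := Nat.mul_le_mul_right _ h2
    _ = a * 2 ^ (n + 1) * 2 ^ j * 2 ^ (m * (2 * m + 8) + 2) := by rw [e]; ring
    _ ≤ a * 2 ^ (n + 1) * 2 ^ j * (b * 2 ^ E * 2 ^ m.choose 3) := Nat.mul_le_mul_left _ h3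
    _ = _ := by ring

theorem card_cubic (m : ℕ) :
    Fintype.card ({A : Finset (Fin m) // A.card = 3} → ZMod 2) = 2 ^ m.choose 3 := by
  simp [Fintype.card_subtype]

theorem exists_extendCubic_of_ten_le {m : ℕ} (hm : 10 ≤ m) :
    ∃ t : {A : Finset (Fin m) // A.card = 3} → ZMod 2, ∀ S : Finset (Fin m → ZMod 2),
      Realizes (extendCubic t) S → 2 * m + 10 ≤ S.card := by
  classical
  by_contra hcon
  push Not at hcon
  choose F hF hlt using hcon
  have hsub : (Finset.univ : Finset ({A : Finset (Fin m) // A.card = 3} → ZMod 2)) ⊆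
      ((Finset.range (2 * m + 9)).biUnion fun s => Finset.univ.filter fun t => (F t).card = s ∧
        (∀ p, ¬ IsDegenerate (F t) p) ∧ ¬ IsPeriodic (F t)) ∪
      ((Finset.univ.biUnion fun p => Finset.univ.filter fun t => IsDegenerate (F t) p) ∪
        Finset.univ.filter fun t => IsPeriodic (F t)) := by
    intro t _
    have h1 := hlt t
    have h2 : (F t).card < 2 * m + 9 := by
      obtain ⟨j, hj⟩ := (hF t).even_card
      omega
    simp only [Finset.mem_union, Finset.mem_biUnion, Finset.mem_filter, Finset.mem_univ, true_and,
      Finset.mem_range]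
    by_cases hper : IsPeriodic (F t)
    · exact Or.inr (Or.inr hper)
    by_cases hdeg : ∃ p, IsDegenerate (F t) p
    · exact Or.inr (Or.inl hdeg)
    push Not at hdeg
    exact Or.inl ⟨_, h2, rfl, hdeg, hper⟩
  have hcard := Finset.card_le_card hsub
  rw [Finset.card_univ, card_cubic] at hcard
  have hcard := (hcard.trans (Finset.card_union_le _ _)).trans
    (Nat.add_le_add_left (Finset.card_union_le _ _) _)
  set C := m.choose 3 with hC
  have b1 : 2 * ((Finset.range (2 * m + 9)).biUnion fun s =>
      Finset.univ.filter fun t => (F t).card = s ∧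
        (∀ p, ¬ IsDegenerate (F t) p) ∧ ¬ IsPeriodic (F t)).card ≤ 2 ^ C := by
    have h1 : 2 ^ (2 * m + 10) * ((Finset.range (2 * m + 9)).biUnion fun s =>
        Finset.univ.filter fun t => (F t).card = s ∧
          (∀ p, ¬ IsDegenerate (F t) p) ∧ ¬ IsPeriodic (F t)).card ≤
        ∑ s ∈ Finset.range (2 * m + 9), 2 ^ s * 2 ^ C := by
      refine (Nat.mul_le_mul_left _ Finset.card_biUnion_le).trans ?_
      rw [Finset.mul_sum]
      refine Finset.sum_le_sum fun s hs => ?_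
      exact two_pow_mul_card_le hm F hF s (by rw [Finset.mem_range] at hs; omega)
    rw [← Finset.sum_mul] at h1
    have h2 : ∑ s ∈ Finset.range (2 * m + 9), 2 ^ s ≤ 2 ^ (2 * m + 9) :=
      (Nat.geomSum_lt le_rfl fun k hk => Finset.mem_range.1 hk).le
    have h3 := h1.trans (Nat.mul_le_mul_right _ h2)
    rw [show 2 * m + 10 = (2 * m + 9) + 1 by ring, pow_succ, mul_assoc] at h3
    exact Nat.le_of_mul_le_mul_left h3 (by positivity)
  have b2 : 4 * (Finset.univ.biUnion fun p =>
      Finset.univ.filter fun t => IsDegenerate (F t) p).card ≤ 2 ^ C := by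
    have h1 : (Finset.univ.biUnion fun p =>
        Finset.univ.filter fun t => IsDegenerate (F t) p).card
        ≤ m * (2 ^ m * 2 ^ ((m - 1).choose 3)) := by
      refine Finset.card_biUnion_le.trans ?_
      refine (Finset.sum_le_card_nsmul _ _ _ fun p _ => card_degenerate_le F hF p).trans ?_
      simp
    have h2 : 2 + m + m + (m - 1).choose 3 ≤ C := by
      obtain ⟨n, rfl⟩ : ∃ n, m = n + 1 := ⟨m - 1, by omega⟩
      have h3 : (n + 1).choose 3 = n.choose 2 + n.choose 3 := Nat.choose_succ_succ' n 2
      have h4 := le_choose_two hm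
      have h5 : (n + 1).choose 2 = n + n.choose 2 := by
        rw [Nat.choose_succ_succ' n 1, Nat.choose_one_right]
      rw [hC, h3, Nat.add_sub_cancel]
      omega
    calc _ ≤ 4 * (m * (2 ^ m * 2 ^ ((m - 1).choose 3))) := Nat.mul_le_mul_left _ h1
      _ ≤ 4 * (2 ^ m * (2 ^ m * 2 ^ ((m - 1).choose 3))) :=
        Nat.mul_le_mul_left _ (Nat.mul_le_mul_right _ Nat.lt_two_pow_self.le)
      _ = 2 ^ (2 + m + m + (m - 1).choose 3) := by rw [pow_add, pow_add, pow_add]; ring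
      _ ≤ _ := Nat.pow_le_pow_right (by norm_num) h2
  have b3 : 8 * (Finset.univ.filter fun t => IsPeriodic (F t)).card ≤ 2 ^ C := by
    calc _ ≤ 8 * 2 ^ (m * m + m + 1) := Nat.mul_le_mul_left _ (card_periodic_le F hF)
      _ = 2 ^ (m * m + m + 4) := by rw [pow_succ, pow_add _ _ 4]; ring
      _ ≤ _ := Nat.pow_le_pow_right (by norm_num) (le_choose_three hm)
  have : 0 < 2 ^ C := by positivity
  omega

section ReedMuller

variable {m : ℕ}

theorem eval_repPoly (f : BF m) (v : Fin m → ZMod 2) : eval v (repPoly f) = f v := by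
  have hterm : ∀ w : Fin m → ZMod 2, ∏ i, (v i + (w i + 1)) = if w = v then 1 else 0 := by
    intro w
    have h : ∀ a b : ZMod 2, a + (b + 1) = if b = a then 1 else 0 := by decide
    simp only [h, Finset.prod_ite_zero, Finset.prod_const_one, Finset.mem_univ, true_implies,
      _root_.funext_iff]
  simp [repPoly, smul_eval, hterm]

theorem sum_mul_prod_eq_zero {f : BF m} {A : Finset (Fin m)} (h : deg f + A.card < m) :
    ∑ v, f v * ∏ i ∈ A, v i = 0 := by
  have hdeg : (repPoly f * ∏ i ∈ A, X i).totalDegree < m := by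
    refine (totalDegree_mul _ _).trans_lt (lt_of_le_of_lt (Nat.add_le_add_left ?_ _) h)
    refine (totalDegree_finsetProd _ _).trans ?_
    simp
  have := sum_eval_eq_zero (repPoly f * ∏ i ∈ A, X i) (by simpa [ZMod.card] using hdeg)
  simpa [eval_prod, eval_repPoly] using this

/-- The Boolean function whose homogeneous part of codegree three has coefficients `t`. -/
def cubicDual (t : Finset (Fin m) → ZMod 2) : BF m :=
  fun v => ∑ B ∈ Finset.univ.powersetCard 3, t B * ∏ i ∈ Bᶜ, v i

theorem repPoly_prod (B : Finset (Fin m)) :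
    repPoly (fun v => ∏ i ∈ B, v i) = ∏ i ∈ B, X i := by
  have h := Finset.prod_univ_sum (fun _ : Fin m => (Finset.univ : Finset (ZMod 2)))
    (fun i a => (if i ∈ B then C a else 1) *
      (X i + C (a + 1) : MvPolynomial (Fin m) (ZMod 2)))
  have huniv : (Finset.univ : Finset (ZMod 2)) = {0, 1} := rfl
  have hl : ∀ i, ∑ a : ZMod 2, (if i ∈ B then C a else 1) *
      (X i + C (a + 1) : MvPolynomial (Fin m) (ZMod 2)) = if i ∈ B then X i else 1 := by
    intro i
    rw [huniv, Finset.sum_pair zero_ne_one]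
    have h2 : (1 : ZMod 2) + 1 = 0 := rfl
    have h3 : (X i : MvPolynomial (Fin m) (ZMod 2)) + X i = 0 := CharTwo.add_self_eq_zero _
    split_ifs
    · simp [h2]
    · simp only [zero_add, map_one, h2, map_zero]
      linear_combination h3
  simp only [hl, Fintype.piFinset_univ, Finset.prod_mul_distrib] at h
  rw [Finset.prod_ite_mem, Finset.univ_inter] at h
  rw [h, repPoly]
  refine Finset.sum_congr rfl fun v _ => ?_
  rw [Finset.prod_ite_mem, Finset.univ_inter, smul_eq_C_mul, map_prod]

theorem deg_cubicDual_le (t : Finset (Fin m) → ZMod 2) : deg (cubicDual t) ≤ m - 3 := by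
  have h : repPoly (cubicDual t) = ∑ B ∈ Finset.univ.powersetCard 3, t B • ∏ i ∈ Bᶜ, X i := by
    simp only [← repPoly_prod]
    simp only [repPoly, cubicDual, Finset.sum_smul, Finset.smul_sum, smul_smul]
    exact Finset.sum_comm
  rw [deg, h]
  refine totalDegree_finsetSum_le fun B hB => (totalDegree_smul_le _ _).trans ?_
  refine (totalDegree_finsetProd _ _).trans ?_
  rw [Finset.mem_powersetCard] at hB
  simp [Finset.card_compl, hB.2]

theorem sum_cubicDual_mul_prod (t : Finset (Fin m) → ZMod 2) {A : Finset (Fin m)}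
    (hA : A.card = 3) : ∑ v, cubicDual t v * ∏ i ∈ A, v i = t A := by
  have key : ∀ B ∈ (Finset.univ : Finset (Fin m)).powersetCard 3,
      ∑ v : Fin m → ZMod 2, (∏ i ∈ Bᶜ, v i) * ∏ i ∈ A, v i = if B = A then 1 else 0 := by
    intro B hB
    have h := Finset.prod_univ_sum (fun _ : Fin m => (Finset.univ : Finset (ZMod 2)))
      (fun i a => (if i ∈ Bᶜ then a else 1) * if i ∈ A then a else 1)
    simp only [Fintype.piFinset_univ, Finset.prod_mul_distrib, Finset.prod_ite_mem,
      Finset.univ_inter] at h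
    have huniv : (Finset.univ : Finset (ZMod 2)) = {0, 1} := rfl
    have hl : ∀ i, ∑ a : ZMod 2, ((if i ∈ Bᶜ then a else 1) * if i ∈ A then a else 1) =
        if i ∈ B → i ∈ A then 1 else 0 := by
      intro i
      rw [huniv, Finset.sum_pair zero_ne_one]
      simp only [Finset.mem_compl]
      by_cases h1 : i ∈ B <;> by_cases h2 : i ∈ A <;> simp [h1, h2]
      rfl
    simp only [hl, Finset.prod_ite_zero, Finset.prod_const_one, Finset.mem_univ,
      true_implies] at h
    rw [← h]
    refine if_congr ?_ rfl rfl
    rw [Finset.mem_powersetCard] at hB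
    refine ⟨fun hsub => Finset.eq_of_subset_of_card_le hsub (by omega), ?_⟩
    rintro rfl
    exact fun _ => id
  simp only [cubicDual, Finset.sum_mul]
  rw [Finset.sum_comm]
  simp only [mul_assoc, ← Finset.mul_sum]
  rw [Finset.sum_congr rfl fun B hB => by rw [key B hB]]
  simp [hA]

theorem realizes_support_add (hm : 4 ≤ m) (t : Finset (Fin m) → ZMod 2) {p : BF m}
    (hp : deg p ≤ m - 4) :
    Realizes t (Finset.univ.filter fun v => (cubicDual t + p) v = 1) := by
  have hsum : ∀ A : Finset (Fin m),
      ∑ v ∈ Finset.univ.filter (fun v => (cubicDual t + p) v = 1), ∏ i ∈ A, v i =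
        ∑ v, cubicDual t v * ∏ i ∈ A, v i + ∑ v, p v * ∏ i ∈ A, v i := by
    intro A
    rw [Finset.sum_filter, ← Finset.sum_add_distrib]
    refine Finset.sum_congr rfl fun v _ => ?_
    rw [← add_mul, ← Pi.add_apply]
    rcases zmod2_eq_zero_or_one ((cubicDual t + p) v) with h | h <;> simp only [h] <;> simp
  have hdeg := deg_cubicDual_le t
  refine ⟨fun A hA => ?_, fun A hA => ?_⟩
  · rw [hsum, sum_mul_prod_eq_zero (by omega), sum_mul_prod_eq_zero (by omega), add_zero]
  · rw [hsum, sum_cubicDual_mul_prod t hA, sum_mul_prod_eq_zero (by omega), add_zero]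

end ReedMuller

theorem exists_realizes_card_ge {m : ℕ} (hm : 8 ≤ m) :
    ∃ t : Finset (Fin m) → ZMod 2, ∀ S, Realizes t S → 2 * m + 10 ≤ S.card := by
  obtain rfl | rfl | h : m = 8 ∨ m = 9 ∨ 10 ≤ m := by omega
  · exact ⟨t8, fun S hS => card_ge_of_realizes_t8 S hS⟩
  · exact ⟨t9, fun S hS => card_ge_of_realizes_t9 S hS⟩
  · obtain ⟨t, ht⟩ := exists_extendCubic_of_ten_le h
    exact ⟨extendCubic t, ht⟩

/-- Theorem 8.2: for every `m ≥ 8`, the covering radius of `RM(m-4, m)` in `RM(m-3, m)`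
is at least `2m + 10`. -/
theorem stmt6 (m : ℕ) (hm : 8 ≤ m) :
    ∃ f : BF m, deg f ≤ m - 3 ∧
      ∀ p : BF m, deg p ≤ m - 4 → 2 * m + 10 ≤ wt (f + p) := by
  obtain ⟨t, ht⟩ := exists_realizes_card_ge hm
  exact ⟨cubicDual t, deg_cubicDual_le t,
    fun p hp => ht _ (realizes_support_add (by omega) t hp)⟩
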